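/- arXiv:2211.04329 — 12 statements merged into one kernel-verified Lean document; each statement's English description precedes it below -/
import Mathlib

section
/- For every prime power q and every integer n ≥ 2, there exists an (n, 1)-set in PG(n, q) of size (q-1)^(n-1); that is, a set of (q-1)^(n-1) points of PG(n, q) such that no line of PG(n, q) contains more than n of its points. -/
/-- `X` is a `(r, s)`-set of `PG(n, q)`: a set of points (1-dimensional linear
subspaces of `F^(n+1)`) such that every `s`-space (an `(s+1)`-dimensional linear
subspace of `F^(n+1)`) contains at most `r` of its points. -/
def IsRSSet (F : Type) [Field F] (n r s : ℕ)
    (X : Set (Submodule F (Fin (n + 1) → F))) : Prop :=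
  (∀ P ∈ X, Module.finrank F P = 1) ∧
    ∀ W : Submodule F (Fin (n + 1) → F), Module.finrank F W = s + 1 →
      {P ∈ X | P ≤ W}.ncard ≤ r

/-- The point `(1, (∏ i, y i)⁻¹, y)` of the affine hypersurface `x₁ ⋯ xₘ₊₁ = 1`. -/
def hyperboloidVec {F : Type} [Field F] {m : ℕ} (y : Fin m → Fˣ) : Fin (m + 1 + 1) → F :=
  Fin.cons 1 (Fin.cons (∏ i, (y i : F))⁻¹ fun i => (y i : F))

section hyperboloidVec

variable {F : Type} [Field F] {m : ℕ}

@[simp]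
lemma hyperboloidVec_zero (y : Fin m → Fˣ) : hyperboloidVec y 0 = 1 := rfl

lemma hyperboloidVec_ne_zero (y : Fin m → Fˣ) : hyperboloidVec y ≠ 0 := fun h => by
  simpa using congrFun h 0

lemma prod_hyperboloidVec (y : Fin m → Fˣ) :
    ∏ i : Fin (m + 1), hyperboloidVec y i.succ = 1 := by
  simp only [hyperboloidVec, Fin.cons_succ, Fin.prod_univ_succ, Fin.cons_zero]
  exact inv_mul_cancel₀ (Finset.prod_ne_zero_iff.2 fun i _ => (y i).ne_zero)

lemma hyperboloidVec_injective :
    Function.Injective (hyperboloidVec : (Fin m → Fˣ) → Fin (m + 1 + 1) → F) := by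
  intro y z h
  funext i
  simpa [hyperboloidVec, Units.ext_iff] using congrFun h i.succ.succ

lemma span_hyperboloidVec_injective :
    Function.Injective fun y : Fin m → Fˣ => Submodule.span F {hyperboloidVec y} := by
  intro y z h
  have hy : hyperboloidVec y ∈ Submodule.span F {hyperboloidVec z} :=
    (Submodule.span_singleton_le_iff_mem _ _).1 h.le
  obtain ⟨c, hc⟩ := Submodule.mem_span_singleton.1 hy
  have hc1 : c = 1 := by simpa using congrFun hc 0
  rw [hc1, one_smul] at hc
  exact hyperboloidVec_injective hc.symm

end hyperboloidVec

open Polynomial in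
/-- A product of `n` polynomials of degree at most one, not all constant, takes the value `1`
at most `n` times. -/
lemma exists_finset_prod_add_mul_eq_one {F : Type} [Field F] {n : ℕ} (a b : Fin n → F)
    (hb : b ≠ 0) :
    ∃ s : Finset F, s.card ≤ n ∧ ∀ t, ∏ i, (a i + b i * t) = 1 → t ∈ s := by
  classical
  obtain ⟨j, hj⟩ := Function.ne_iff.1 hb
  set p : F[X] := ∏ i, (C (b i) * X + C (a i)) with hp
  have hp1 : p - 1 ≠ 0 := by
    intro h
    have hunit : IsUnit (C (b j) * X + C (a j)) :=
      isUnit_of_dvd_one (sub_eq_zero.1 h ▸ Finset.dvd_prod_of_mem _ (Finset.mem_univ j))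
    have h0 := natDegree_eq_zero_of_isUnit hunit
    rw [natDegree_linear hj] at h0
    exact one_ne_zero h0
  refine ⟨(p - 1).roots.toFinset, ?_, fun t ht => ?_⟩
  · have hdeg : p.natDegree ≤ n := by
      refine (natDegree_prod_le _ _).trans ?_
      exact (Finset.sum_le_card_nsmul Finset.univ _ 1 fun i _ => natDegree_linear_le).trans
        (by simp)
    calc _ ≤ (p - 1).roots.card := Multiset.toFinset_card_le _
      _ ≤ (p - 1).natDegree := card_roots' _
      _ ≤ n := (natDegree_sub_le _ _).trans (by simpa using hdeg)
  · rw [Multiset.mem_toFinset, mem_roots hp1, IsRoot.def, hp]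
    simp only [eval_sub, eval_prod, eval_add, eval_mul, eval_C, eval_X, eval_one]
    rw [← ht, sub_eq_zero]
    exact Finset.prod_congr rfl fun i _ => add_comm _ _

/-- The vectors of a plane on which a linear functional takes the same nonzero value as at `u`
form an affine line through `u`. -/
lemma exists_direction_of_finrank_eq_two {F V : Type*} [Field F] [AddCommGroup V] [Module F V]
    {W : Submodule F V} (hW : Module.finrank F W = 2) (φ : V →ₗ[F] F) {u : V} (hu : u ∈ W)
    (hφ : φ u ≠ 0) :
    ∃ b ≠ 0, φ b = 0 ∧ ∀ w ∈ W, φ w = φ u → ∃ t : F, w = u + t • b := by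
  have : FiniteDimensional F W := Module.finite_of_finrank_pos (by omega)
  set ψ : W →ₗ[F] F := φ ∘ₗ W.subtype
  have hψ : Function.Surjective ψ := LinearMap.surjective fun h =>
    hφ (by simpa [ψ] using LinearMap.congr_fun h ⟨u, hu⟩)
  have hker : Module.finrank F (LinearMap.ker ψ) = 1 := by
    have := LinearMap.finrank_range_add_finrank_ker ψ
    rw [LinearMap.range_eq_top.2 hψ, finrank_top, Module.finrank_self, hW] at this
    omega
  obtain ⟨b, hb, hspan⟩ := finrank_eq_one_iff'.1 hker
  refine ⟨b, by simpa using hb, LinearMap.mem_ker.1 b.2, fun w hw hwu => ?_⟩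
  obtain ⟨t, ht⟩ := hspan ⟨⟨w, hw⟩ - ⟨u, hu⟩, by simp [ψ, hwu]⟩
  refine ⟨t, ?_⟩
  have := congrArg (fun x : LinearMap.ker ψ => ((x : W) : V)) ht
  simp only [Submodule.coe_smul, AddSubgroupClass.coe_sub] at this
  rw [this, add_sub_cancel]

theorem exists_n_one_set (q n : ℕ) (F : Type) [Field F] [Fintype F]
    (hF : Fintype.card F = q) (hn : 2 ≤ n) :
    ∃ X : Set (Submodule F (Fin (n + 1) → F)),
      IsRSSet F n n 1 X ∧ X.ncard = (q - 1) ^ (n - 1) := by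
  classical
  obtain ⟨m, rfl⟩ : ∃ m, n = m + 1 := ⟨n - 1, by omega⟩
  refine ⟨Set.range fun y : Fin m → Fˣ => Submodule.span F {hyperboloidVec y},
    ⟨?_, fun W hW => ?_⟩, ?_⟩
  · rintro _ ⟨y, rfl⟩
    exact finrank_span_singleton (hyperboloidVec_ne_zero y)
  · rcases Set.eq_empty_or_nonempty
      {P ∈ Set.range fun y : Fin m → Fˣ => Submodule.span F {hyperboloidVec y} | P ≤ W}
      with hempty | ⟨_, ⟨y, rfl⟩, hy⟩
    · rw [hempty, Set.ncard_empty]; exact Nat.zero_le _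
    have hyW : hyperboloidVec y ∈ W := (Submodule.span_singleton_le_iff_mem _ _).1 hy
    obtain ⟨b, hb, hb0, hline⟩ := exists_direction_of_finrank_eq_two hW
      (LinearMap.proj 0 : (Fin (m + 1 + 1) → F) →ₗ[F] F) hyW (by simp)
    have hb' : (fun i : Fin (m + 1) => b i.succ) ≠ 0 := fun h => hb <| funext fun i => by
      refine Fin.cases hb0 (fun j => congrFun h j) i
    obtain ⟨s, hs, hmem⟩ := exists_finset_prod_add_mul_eq_one
      (fun i : Fin (m + 1) => hyperboloidVec y i.succ) _ hb'
    refine le_trans ?_ hs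
    rw [← Set.ncard_coe_finset s]
    refine le_trans (Set.ncard_le_ncard ?_ ((s.finite_toSet).image _)) (Set.ncard_image_le
      (f := fun t => Submodule.span F {hyperboloidVec y + t • b}) s.finite_toSet)
    rintro _ ⟨⟨z, rfl⟩, hz⟩
    obtain ⟨t, ht⟩ := hline _ ((Submodule.span_singleton_le_iff_mem _ _).1 hz) (by simp)
    refine ⟨t, hmem t ?_, by simp only [ht]⟩
    rw [← prod_hyperboloidVec z, ht]
    exact Finset.prod_congr rfl fun i _ => by simp [mul_comm]
  · rw [← Set.image_univ, Set.ncard_image_of_injective _ span_hyperboloidVec_injective,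
      Set.ncard_univ, Nat.card_eq_fintype_card, Fintype.card_fun, Fintype.card_units, hF,
      Fintype.card_fin, Nat.add_sub_cancel]
end

section
/- Let n > s ≥ 1 and r be integers with s + 1 ≥ r ≥ 3. For every ε > 0 there exists q₀ such that for every prime power q ≥ q₀ there exists an (r, s)-set in PG(n, q) of size at least ((r! - 1)/r! - ε) · q^(n - s - s(n-s)/r). -/
open Module

section GenericPointSet

variable {F V : Type*} [Field F] [AddCommGroup V] [Module F V]

/-- A set of points spanning subspaces of full dimension up to vector-space dimension `k`:
a subspace of dimension `d ≤ k` contains at most `d` of the points. -/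
def IsGenericPointSet (k : ℕ) (X : Set (Submodule F V)) : Prop :=
  (∀ P ∈ X, finrank F P = 1) ∧
    ∀ W : Submodule F V, finrank F W ≤ k → {P ∈ X | P ≤ W}.ncard ≤ finrank F W

theorem isGenericPointSet_empty (k : ℕ) : IsGenericPointSet k (∅ : Set (Submodule F V)) :=
  ⟨by simp, by simp⟩

/-- Greedy step: a point lying in no span of at most `k` points of `X` can be added to `X`. -/
theorem IsGenericPointSet.insert_span_singleton [Finite F] [FiniteDimensional F V] {k : ℕ}
    {X : Set (Submodule F V)} (hX : IsGenericPointSet k X) {v : V}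
    (hv : ∀ Y ⊆ X, Y.ncard ≤ k → v ∉ sSup Y) :
    IsGenericPointSet k (insert (F ∙ v) X) := by
  have : Finite V := Module.finite_of_finite F
  have hv0 : v ≠ 0 := fun h => hv ∅ (Set.empty_subset X) (by simp) (by simp [h])
  refine ⟨?_, fun W hW => ?_⟩
  · rintro P (rfl | hP)
    · exact finrank_span_singleton hv0
    · exact hX.1 P hP
  have hYcard := hX.2 W hW
  set Y := {P ∈ X | P ≤ W} with hY
  by_cases hvW : F ∙ v ≤ W
  · have hlt : sSup Y < W := by
      refine lt_of_le_of_ne (sSup_le fun P hP => hP.2) fun h => ?_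
      exact hv Y (Set.sep_subset _ _) (hYcard.trans hW)
        (h ▸ (Submodule.span_singleton_le_iff_mem _ _).1 hvW)
    have hrank := Submodule.finrank_lt_finrank_of_lt hlt
    have hYlt : Y.ncard < finrank F W := by
      refine lt_of_le_of_lt (le_trans ?_ (hX.2 (sSup Y) (hrank.le.trans hW))) hrank
      exact Set.ncard_le_ncard (fun P hP => ⟨hP.1, le_sSup hP⟩) (Set.toFinite _)
    calc {P ∈ insert (F ∙ v) X | P ≤ W}.ncard ≤ (insert (F ∙ v) Y).ncard := by
          refine Set.ncard_le_ncard ?_ (Set.toFinite _)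
          rintro P ⟨rfl | hP, hPW⟩
          · exact Or.inl rfl
          · exact Or.inr ⟨hP, hPW⟩
      _ ≤ Y.ncard + 1 := Set.ncard_insert_le _ _
      _ ≤ finrank F W := hYlt
  · refine le_trans (Set.ncard_le_ncard ?_ (Set.toFinite _)) hYcard
    rintro P ⟨rfl | hP, hPW⟩
    · exact absurd hPW hvW
    · exact ⟨hP, hPW⟩

/-- Few points do not have enough spans of at most `k` of them to cover the whole space. -/
theorem exists_notMem_sSup [Fintype F] [FiniteDimensional F V] {k : ℕ}
    {X : Set (Submodule F V)} (hX : ∀ P ∈ X, finrank F P = 1) (hne : X.Nonempty)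
    (hcard : X.ncard ^ k * Fintype.card F ^ k < Fintype.card F ^ finrank F V) :
    ∃ v : V, ∀ Y ⊆ X, Y.ncard ≤ k → v ∉ sSup Y := by
  have : Finite V := Module.finite_of_finite F
  have : Nonempty X := hne.to_subtype
  have hgen : ∀ P : X, ∃ v : V, F ∙ v = P.1 := fun P => by
    obtain ⟨w, -, hw⟩ := finrank_eq_one_iff'.1 (hX P P.2)
    refine ⟨w, le_antisymm ?_ fun x hx => ?_⟩
    · exact (Submodule.span_singleton_le_iff_mem _ _).2 w.2
    · obtain ⟨c, hc⟩ := hw ⟨x, hx⟩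
      exact Submodule.mem_span_singleton.2 ⟨c, congrArg Subtype.val hc⟩
  choose g hg using hgen
  by_contra! hcov
  have hsurj : Function.Surjective
      (fun p : (Fin k → X) × (Fin k → F) => ∑ i, p.2 i • g (p.1 i)) := fun v => by
    obtain ⟨Y, hYX, hYk, hvY⟩ := hcov v
    obtain ⟨f, hf⟩ : ∃ f : Fin k → X, ∀ P ∈ Y, ∃ i, (f i).1 = P := by
      rcases Y.eq_empty_or_nonempty with rfl | hYne
      · exact ⟨fun _ => Classical.arbitrary X, by simp⟩
      have : Nonempty Y := hYne.to_subtype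
      have : Fintype Y := Fintype.ofFinite Y
      obtain ⟨e⟩ : Nonempty (Y ↪ Fin k) := Function.Embedding.nonempty_of_card_le <| by
        rwa [Fintype.card_fin, ← Nat.card_eq_fintype_card, Nat.card_coe_set_eq]
      refine ⟨fun i => Set.inclusion hYX (Function.invFun e i), fun P hP => ⟨e ⟨P, hP⟩, ?_⟩⟩
      simp [Function.leftInverse_invFun e.injective _]
    have hle : sSup Y ≤ Submodule.span F (Set.range fun i => g (f i)) := by
      refine sSup_le fun P hP => ?_
      obtain ⟨i, rfl⟩ := hf P hP
      rw [← hg, Submodule.span_singleton_le_iff_mem]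
      exact Submodule.subset_span ⟨i, rfl⟩
    obtain ⟨c, hc⟩ := (Submodule.mem_span_range_iff_exists_fun F).1 (hle hvY)
    exact ⟨(f, c), hc⟩
  have := Nat.card_le_card_of_surjective _ hsurj
  rw [Module.natCard_eq_pow_finrank (K := F)] at this
  simp only [Nat.card_prod, Nat.card_fun, Fintype.card_fun, Nat.card_eq_fintype_card, Fintype.card_fin,
    Nat.card_coe_set_eq] at this
  omega

/-- Gilbert–Varshamov: there is a generic point set of at least the size at which
the greedy algorithm may first get stuck. -/
theorem exists_isGenericPointSet_pow_le [Fintype F] [FiniteDimensional F V] {k : ℕ} (hk : k ≠ 0)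
    (hkV : k ≤ finrank F V) :
    ∃ X : Set (Submodule F V), IsGenericPointSet k X ∧ X.Nonempty ∧
      Fintype.card F ^ (finrank F V - k) ≤ X.ncard ^ k := by
  have : Finite V := Module.finite_of_finite F
  obtain ⟨X, hX⟩ := (Set.toFinite {X : Set (Submodule F V) | IsGenericPointSet k X}).exists_maximal
    ⟨∅, isGenericPointSet_empty k⟩
  have hadd : ∀ v : V, ∃ Y ⊆ X, Y.ncard ≤ k ∧ v ∈ sSup Y := by
    by_contra! ⟨v, hv⟩
    have hmem : F ∙ v ∈ X :=
      hX.2 (hX.1.insert_span_singleton hv) (Set.subset_insert _ _) (Set.mem_insert _ _)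
    refine hv {F ∙ v} (by simpa using hmem) (by simp; omega) ?_
    simp [Submodule.mem_span_singleton_self]
  have hne : X.Nonempty := by
    by_contra! rfl
    have : Nontrivial V := Module.nontrivial_of_finrank_pos (R := F) (by omega)
    obtain ⟨v, hv⟩ := exists_ne (0 : V)
    obtain ⟨Y, hY, -, hvY⟩ := hadd v
    obtain rfl := Set.subset_empty_iff.1 hY
    exact hv (by simpa using hvY)
  refine ⟨X, hX.1, hne, ?_⟩
  by_contra! hlt
  obtain ⟨v, hv⟩ := exists_notMem_sSup hX.1.1 hne (k := k) <| by
    calc X.ncard ^ k * Fintype.card F ^ k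
        < Fintype.card F ^ (finrank F V - k) * Fintype.card F ^ k :=
          Nat.mul_lt_mul_of_pos_right hlt (pow_pos Fintype.card_pos k)
      _ = Fintype.card F ^ finrank F V := by rw [← pow_add, Nat.sub_add_cancel hkV]
  obtain ⟨Y, hY, hYk, hvY⟩ := hadd v
  exact hv Y hY hYk hvY

end GenericPointSet

theorem gilbert_varshamov_type_bound (n r s : ℕ) (hs : 1 ≤ s) (hns : s < n)
    (hr3 : 3 ≤ r) (hrs : r ≤ s + 1) (ε : ℝ) (hε : 0 < ε) :
    ∃ q₀ : ℕ, ∀ (q : ℕ), q₀ ≤ q → ∀ (F : Type) [Field F] [Fintype F],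
      Fintype.card F = q →
        ∃ X : Set (Submodule F (Fin (n + 1) → F)),
          IsRSSet F n r s X ∧
          (((Nat.factorial r : ℝ) - 1) / (Nat.factorial r : ℝ) - ε) *
              (q : ℝ) ^ ((n : ℝ) - (s : ℝ) - (s : ℝ) * ((n : ℝ) - (s : ℝ)) / (r : ℝ))
            ≤ (X.ncard : ℝ) := by
  refine ⟨0, fun q _ F _ _ hq => ?_⟩
  have hq1 : (1 : ℝ) ≤ q := by
    rw [← hq]
    exact_mod_cast Fintype.card_pos (α := F)
  obtain ⟨X, hX, hne, hcard⟩ :=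
    exists_isGenericPointSet_pow_le (F := F) (V := Fin (n + 1) → F) (k := s + 1)
      (by omega) (by simp; omega)
  have hcoef : ((Nat.factorial r : ℝ) - 1) / (Nat.factorial r : ℝ) - ε ≤ 1 := by
    have hr0 : (0 : ℝ) < Nat.factorial r := by positivity
    have : ((Nat.factorial r : ℝ) - 1) / (Nat.factorial r : ℝ) ≤ 1 := by
      rw [div_le_one hr0]
      linarith
    linarith
  suffices h : ∃ X : Set (Submodule F (Fin (n + 1) → F)), IsRSSet F n r s X ∧
      (q : ℝ) ^ ((n : ℝ) - (s : ℝ) - (s : ℝ) * ((n : ℝ) - (s : ℝ)) / (r : ℝ))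
        ≤ (X.ncard : ℝ) by
    obtain ⟨X, hX, hle⟩ := h
    exact ⟨X, hX, (mul_le_of_le_one_left (by positivity) hcoef).trans hle⟩
  have hr0 : (0 : ℝ) < r := by positivity
  rcases hrs.lt_or_eq with hlt | rfl
  · obtain ⟨P, hP⟩ := hne
    refine ⟨{P}, ⟨by simpa using hX.1 P hP, fun W _ => ?_⟩, ?_⟩
    · have : {Q ∈ ({P} : Set (Submodule F (Fin (n + 1) → F))) | Q ≤ W}.ncard ≤ 1 := by
        simpa using Set.ncard_le_ncard (Set.sep_subset {P} (· ≤ W)) (Set.finite_singleton P)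
      omega
    · rw [Set.ncard_singleton, Nat.cast_one]
      refine Real.rpow_le_one_of_one_le_of_nonpos hq1 ?_
      have hrs' : (r : ℝ) ≤ s := by exact_mod_cast Nat.lt_succ_iff.1 hlt
      have hns' : (s : ℝ) ≤ n := by exact_mod_cast hns.le
      rw [sub_nonpos, le_div_iff₀ hr0]
      nlinarith
  · refine ⟨X, ⟨hX.1, fun W hW => (hX.2 W hW.le).trans_eq hW⟩, ?_⟩
    rw [finrank_fin_fun, hq, Nat.add_sub_add_right] at hcard
    have hexp : (n : ℝ) - s - s * ((n : ℝ) - s) / ((s + 1 : ℕ) : ℝ)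
        = ((n - s : ℕ) : ℝ) * ((s + 1 : ℕ) : ℝ)⁻¹ := by
      rw [Nat.cast_sub hns.le]
      push_cast
      field_simp
      ring
    rw [hexp, Real.rpow_mul (by positivity), Real.rpow_natCast,
      Real.rpow_inv_le_iff_of_pos (by positivity) (by positivity) hr0, Real.rpow_natCast]
    exact_mod_cast hcard
end

section
/- Let q be a prime power and let X be an (r, s)-set in PG(n, q) with n ≥ s ≥ 1 and r ≥ 1. Then |X| ≤ r · ((q^(n-s+1) - 1)/(q - 1) + 1), where (q^(n-s+1) - 1)/(q - 1) is the Gaussian binomial coefficient [n-s+1 choose 1]_q. -/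
/-- Rank formula for the preimage of a subspace under a surjective linear map. -/
theorem Submodule.finrank_comap_of_surjective {K V W : Type*} [Field K] [AddCommGroup V]
    [Module K V] [FiniteDimensional K V] [AddCommGroup W] [Module K W]
    (f : V →ₗ[K] W) (hf : Function.Surjective f) (S : Submodule K W) :
    Module.finrank K (S.comap f) = Module.finrank K S + Module.finrank K (LinearMap.ker f) := by
  have : FiniteDimensional K W := Module.Finite.of_surjective f hf
  have h₁ := (S.mkQ.comp f).finrank_range_add_finrank_ker
  have h₂ := f.finrank_range_add_finrank_ker
  have h₃ := S.finrank_quotient_add_finrank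
  rw [LinearMap.ker_comp, Submodule.ker_mkQ,
    LinearMap.range_comp_of_range_eq_top _ (LinearMap.range_eq_top.2 hf), Submodule.range_mkQ,
    finrank_top] at h₁
  rw [LinearMap.range_eq_top.2 hf, finrank_top] at h₂
  omega

/-- Every point of a projective space lies in the preimage, under a linear map to a nontrivial
space, of some point of the target. -/
theorem Projectivization.exists_le_comap_submodule {K V W : Type*} [Field K] [AddCommGroup V]
    [Module K V] [AddCommGroup W] [Module K W] [Nontrivial W] (f : V →ₗ[K] W)
    {P : Submodule K V} (hP : Module.finrank K P = 1) :
    ∃ p : Projectivization K W, P ≤ p.submodule.comap f := by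
  obtain ⟨v, rfl⟩ : ∃ v, P = Submodule.span K {v} :=
    ⟨_, by rw [← Projectivization.submodule_eq, Projectivization.submodule_mk'' P hP]⟩
  by_cases hv : f v = 0
  · obtain ⟨w, hw⟩ := exists_ne (0 : W)
    exact ⟨.mk K w hw, by simp [Submodule.span_singleton_le_iff_mem, hv]⟩
  · exact ⟨.mk K (f v) hv, by
      simp [Submodule.span_singleton_le_iff_mem, Submodule.mem_span_singleton_self]⟩

/-- An `(r, s)`-set in `PG(n, q)` has at most `r * ([n-s+1 choose 1]_q + 1)` points,
where `[n-s+1 choose 1]_q = (q^(n-s+1) - 1)/(q - 1)` (the division is exact). -/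
theorem cone_bound (q n r s : ℕ) (F : Type) [Field F] [Fintype F]
    (hF : Fintype.card F = q) (hs : 1 ≤ s) (hsn : s ≤ n) (hr : 1 ≤ r)
    (X : Set (Submodule F (Fin (n + 1) → F))) (hX : IsRSSet F n r s X) :
    X.ncard ≤ r * ((q ^ (n - s + 1) - 1) / (q - 1) + 1) := by
  have hV : Module.finrank F (Fin (n + 1) → F) = n + 1 := by simp
  obtain ⟨U, hU⟩ : ∃ U : Submodule F (Fin (n + 1) → F), Module.finrank F U = s := by
    obtain ⟨v, hv⟩ := exists_linearIndependent_of_le_finrank (R := F)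
      (M := Fin (n + 1) → F) (n := s) (by omega)
    exact ⟨_, (finrank_span_eq_card hv).trans (Fintype.card_fin s)⟩
  have hQ : Module.finrank F ((Fin (n + 1) → F) ⧸ U) = n - s + 1 := by
    have := U.finrank_quotient_add_finrank
    omega
  have : Nontrivial ((Fin (n + 1) → F) ⧸ U) := Module.nontrivial_of_finrank_pos (R := F) (by omega)
  have : Finite ((Fin (n + 1) → F) ⧸ U) := Module.finite_of_finite F
  have hcard : Nat.card (Projectivization F ((Fin (n + 1) → F) ⧸ U)) =
      (q ^ (n - s + 1) - 1) / (q - 1) := by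
    rw [Projectivization.card'', Module.natCard_eq_pow_finrank (K := F), hQ,
      Nat.card_eq_fintype_card, hF]
  have := Fintype.ofFinite (Projectivization F ((Fin (n + 1) → F) ⧸ U))
  have hcover : X ⊆ ⋃ p ∈ (Finset.univ : Finset (Projectivization F ((Fin (n + 1) → F) ⧸ U))),
      {P ∈ X | P ≤ p.submodule.comap U.mkQ} := fun P hP ↦ by
    obtain ⟨p, hp⟩ := Projectivization.exists_le_comap_submodule U.mkQ (hX.1 P hP)
    simpa using ⟨hP, p, hp⟩
  calc X.ncard ≤ _ := Set.ncard_le_ncard hcover (Set.toFinite _)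
    _ ≤ _ := Finset.set_ncard_biUnion_le _ _
    _ ≤ _ := Finset.sum_le_card_nsmul _ _ r fun p _ ↦ hX.2 _ <| by
      rw [Submodule.finrank_comap_of_surjective _ U.mkQ_surjective, U.ker_mkQ, hU,
        p.finrank_submodule, add_comm]
    _ = r * ((q ^ (n - s + 1) - 1) / (q - 1)) := by
      rw [Finset.card_univ, ← Nat.card_eq_fintype_card, hcard, smul_eq_mul, mul_comm]
    _ ≤ _ := Nat.mul_le_mul_left _ (Nat.le_succ _)
end

section
/- Let q be a prime power and let x_1, x_2, x_3, x_4, y_1, y_2, y_3, y_4 ∈ F_q. For i = 1, 2, 3, 4 set s_i = (1, x_i, x_i², x_i³, y_i, y_i², y_i³) ∈ F_q^7. Suppose the four vectors s_1, s_2, s_3, s_4 are pairwise distinct and span a linear subspace of F_q^7 of dimension at most 3 (i.e., the four corresponding points of PG(6, q) lie in a common plane). Then the set {x_1, x_2, x_3, x_4} has exactly 2 elements and the set {y_1, y_2, y_3, y_4} has exactly 2 elements. -/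
/-- If a weight `c` annihilates all powers `f ^ k` with `k < #ι`, then every index in the
support of `c` shares its `f`-value with another index in the support. -/
theorem exists_ne_and_eq_of_sum_mul_pow_eq_zero {ι F : Type*} [Field F] [Fintype ι]
    (c f : ι → F) (h : ∀ k < Fintype.card ι, ∑ m, c m * f m ^ k = 0) (i : ι) (hi : c i ≠ 0) :
    ∃ j, j ≠ i ∧ c j ≠ 0 ∧ f j = f i := by
  classical
  by_contra! hcon
  let g : ι → F := fun j => if f j = f i then f i + 1 else f j
  let P : Polynomial F := ∏ j ∈ Finset.univ.erase i, (Polynomial.X - Polynomial.C (g j))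
  have hP : P.natDegree < Fintype.card ι := by
    have : P.natDegree = (Finset.univ.erase i).card :=
      Polynomial.natDegree_finsetProd_X_sub_C_eq_card _ g
    rw [this]
    exact Finset.card_erase_lt_of_mem (Finset.mem_univ i)
  have heval (z : F) : P.eval z = ∏ j ∈ Finset.univ.erase i, (z - g j) := by
    simp [P, Polynomial.eval_prod]
  have hsum : ∑ m, c m * P.eval (f m) = 0 := by
    simp_rw [Polynomial.eval_eq_sum_range' hP, Finset.mul_sum]
    rw [Finset.sum_comm]
    refine Finset.sum_eq_zero fun k hk => ?_
    simp_rw [mul_left_comm (c _)]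
    rw [← Finset.mul_sum, h k (Finset.mem_range.1 hk), mul_zero]
  rw [Finset.sum_eq_single i] at hsum
  · refine (mul_ne_zero hi ?_) hsum
    rw [heval]
    refine Finset.prod_ne_zero_iff.2 fun j _ => ?_
    by_cases hj : f j = f i
    · simp [g, hj]
    · simpa [g, hj, sub_eq_zero] using Ne.symm hj
  · intro m _ hm
    by_cases hc : c m = 0
    · simp [hc]
    · rw [heval, Finset.prod_eq_zero (Finset.mem_erase.2 ⟨hm, Finset.mem_univ m⟩), mul_zero]
      simp [g, hcon m hm hc]
  · simp

/-- Four distinct points of the surface `{(1, x, x², x³, y, y², y³)}` that lie in a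
common plane of `PG(6, q)` have exactly two distinct `x`-coordinates and exactly two
distinct `y`-coordinates. -/
theorem four_coplanar_points (q : ℕ) (F : Type) [Field F] [Fintype F]
    (hF : Fintype.card F = q) (x y : Fin 4 → F)
    (s : Fin 4 → (Fin 7 → F))
    (hs : ∀ i, s i = ![1, x i, (x i) ^ 2, (x i) ^ 3, y i, (y i) ^ 2, (y i) ^ 3])
    (hdist : Function.Injective s)
    (hplane : Module.finrank F (Submodule.span F (Set.range s)) ≤ 3) :
    (Set.range x).ncard = 2 ∧ (Set.range y).ncard = 2 := by
  have hdep : ¬ LinearIndependent F s := fun hli => by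
    have := finrank_span_eq_card hli
    rw [Fintype.card_fin] at this
    omega
  obtain ⟨c, hc, i, hi⟩ := Fintype.not_linearIndependent_iff.1 hdep
  have hcoord (n : Fin 7) : ∑ m, c m * s m n = 0 := by
    simpa using congrFun hc n
  have hx : ∀ k < Fintype.card (Fin 4), ∑ m, c m * x m ^ k = 0 := by
    intro k hk
    rw [Fintype.card_fin] at hk
    interval_cases k
    · simpa [hs] using hcoord 0
    · simpa [hs] using hcoord 1
    · simpa [hs] using hcoord 2
    · simpa [hs] using hcoord 3
  have hy : ∀ k < Fintype.card (Fin 4), ∑ m, c m * y m ^ k = 0 := by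
    intro k hk
    rw [Fintype.card_fin] at hk
    interval_cases k
    · simpa [hs] using hcoord 0
    · simpa [hs] using hcoord 4
    · simpa [hs] using hcoord 5
    · simpa [hs] using hcoord 6
  have hinj {a b : Fin 4} (hab : a ≠ b) (hxab : x a = x b) : y a ≠ y b := fun hyab =>
    hab (hdist (by rw [hs, hs, hxab, hyab]))
  obtain ⟨j, hji, hcj, hxj⟩ := exists_ne_and_eq_of_sum_mul_pow_eq_zero c x hx i hi
  obtain ⟨k, hki, hck, hyk⟩ := exists_ne_and_eq_of_sum_mul_pow_eq_zero c y hy i hi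
  obtain ⟨l, hlj, -, hyl⟩ := exists_ne_and_eq_of_sum_mul_pow_eq_zero c y hy j hcj
  obtain ⟨m, hmk, -, hxm⟩ := exists_ne_and_eq_of_sum_mul_pow_eq_zero c x hx k hck
  have hyji : y j ≠ y i := hinj hji hxj
  have hxki : x k ≠ x i := fun h => hinj hki h hyk
  have hli : l ≠ i := by rintro rfl; exact hyji hyl.symm
  have hlk : l ≠ k := by rintro rfl; exact hyji (hyl.symm.trans hyk)
  have hjk : j ≠ k := by rintro rfl; exact hyji hyk
  have hcover (a : Fin 4) : a = i ∨ a = j ∨ a = k ∨ a = l := by omega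
  have hxl : x l = x k := by
    rcases hcover m with rfl | rfl | rfl | rfl
    · exact absurd hxm.symm hxki
    · exact absurd (hxm.symm.trans hxj) hxki
    · exact absurd rfl hmk
    · exact hxm
  have hrx : Set.range x = {x i, x k} := by
    refine Set.Subset.antisymm ?_ (by rintro _ (rfl | rfl) <;> exact Set.mem_range_self _)
    rintro _ ⟨a, rfl⟩
    rcases hcover a with rfl | rfl | rfl | rfl <;> simp [hxj, hxl]
  have hry : Set.range y = {y i, y j} := by
    refine Set.Subset.antisymm ?_ (by rintro _ (rfl | rfl) <;> exact Set.mem_range_self _)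
    rintro _ ⟨a, rfl⟩
    rcases hcover a with rfl | rfl | rfl | rfl <;> simp [hyk, hyl]
  rw [hrx, hry]
  exact ⟨Set.ncard_pair hxki.symm, Set.ncard_pair hyji.symm⟩
end

section
/- Let q be a prime power and let G ⊆ F_q × F_q be a set of pairs that is C4-free in the bipartite sense: there are no x, x', y, y' ∈ F_q with x ≠ x' and y ≠ y' such that all four pairs (x, y), (x, y'), (x', y), (x', y') lie in G. Let X' = { ⟨(1, x, x², x³, y, y², y³)⟩ : (x, y) ∈ G } ⊆ PG(6, q). Then |X'| = |G| and X' is a (3, 2)-set in PG(6, q), i.e., no plane of PG(6, q) contains more than 3 points of X'. -/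
open Polynomial in
/-- If the first `n` power moments of a weight `c` on at most `n` indexed nodes `z i` vanish, then
the total weight sitting on each node vanishes. -/
theorem sum_fiber_eq_zero_of_moments_eq_zero {ι F : Type*} [Field F] [DecidableEq F] {n : ℕ}
    (S : Finset ι) (hS : S.card ≤ n) (c z : ι → F)
    (h : ∀ k < n, ∑ i ∈ S, c i * z i ^ k = 0) (a : F) :
    ∑ i ∈ S with z i = a, c i = 0 := by
  by_cases ha : a ∈ S.image z
  · set T := (S.image z).erase a with hT
    set P : F[X] := ∏ b ∈ T, (X - C b) with hP
    have hdeg : P.natDegree < n := by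
      have h1 : P.natDegree = T.card := natDegree_finsetProd_X_sub_C_eq_card T id
      have h2 : T.card < (S.image z).card := Finset.card_erase_lt_of_mem ha
      have h3 : (S.image z).card ≤ S.card := Finset.card_image_le
      omega
    have hsum : ∑ i ∈ S, c i * P.eval (z i) = 0 := by
      simp_rw [eval_eq_sum_range' hdeg, Finset.mul_sum]
      rw [Finset.sum_comm]
      refine Finset.sum_eq_zero fun k hk => ?_
      rw [← mul_zero (P.coeff k), ← h k (Finset.mem_range.1 hk), Finset.mul_sum]
      exact Finset.sum_congr rfl fun i _ => by ring
    have hPa : P.eval a ≠ 0 := by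
      rw [hP, eval_prod, Finset.prod_ne_zero_iff]
      intro b hb
      simpa [sub_eq_zero] using (Finset.ne_of_mem_erase hb).symm
    have hfib : (∑ i ∈ S with z i = a, c i) * P.eval a = 0 := by
      rw [← hsum, Finset.sum_mul, Finset.sum_filter]
      refine Finset.sum_congr rfl fun i hi => ?_
      split_ifs with hia
      · rw [hia]
      · have hiT : z i ∈ T := Finset.mem_erase.2 ⟨hia, Finset.mem_image_of_mem z hi⟩
        have : P.eval (z i) = 0 := by
          rw [hP, eval_prod]
          exact Finset.prod_eq_zero hiT (by simp)
        rw [this, mul_zero]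
    exact (mul_eq_zero.1 hfib).resolve_right hPa
  · rw [Finset.filter_false_of_mem, Finset.sum_empty]
    rintro i hi rfl
    exact ha (Finset.mem_image_of_mem z hi)

/-- A term of a vanishing fibre sum that is nonzero has a nonzero companion in the same fibre. -/
theorem exists_ne_of_sum_fiber_eq_zero {ι κ M : Type*} [AddCommMonoid M] [DecidableEq κ]
    {S : Finset ι} {c : ι → M} {z : ι → κ} (h : ∀ a, ∑ i ∈ S with z i = a, c i = 0)
    {i : ι} (hi : i ∈ S) (hc : c i ≠ 0) : ∃ j ∈ S, c j ≠ 0 ∧ z j = z i ∧ j ≠ i := by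
  by_contra! hcon
  refine hc ?_
  rw [← h (z i), eq_comm]
  refine Finset.sum_eq_single_of_mem i (by simp [hi]) fun j hj hji => ?_
  rw [Finset.mem_filter] at hj
  by_contra hcj
  exact hji (hcon j hj.1 hcj hj.2)

/-- A set of at most four edges of a bipartite graph in which every edge has, at each of its
endpoints, another edge of the set, contains a four-cycle as soon as it is nonempty. -/
theorem exists_four_cycle {α β : Type*} {S : Finset (α × β)} (hS : S.card ≤ 4)
    {p : α × β → Prop} (hfst : ∀ e ∈ S, p e → ∃ f ∈ S, p f ∧ f.1 = e.1 ∧ f ≠ e)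
    (hsnd : ∀ e ∈ S, p e → ∃ f ∈ S, p f ∧ f.2 = e.2 ∧ f ≠ e)
    {e : α × β} (he : e ∈ S) (hp : p e) :
    ∃ x x' y y', x ≠ x' ∧ y ≠ y' ∧
      (x, y) ∈ S ∧ (x, y') ∈ S ∧ (x', y) ∈ S ∧ (x', y') ∈ S := by
  classical
  obtain ⟨x, y⟩ := e
  obtain ⟨⟨x₁, y'⟩, h1, p1, hx1, n1⟩ := hfst _ he hp
  obtain ⟨⟨x', y₂⟩, h2, p2, hy2, n2⟩ := hsnd _ he hp
  obtain rfl : x₁ = x := hx1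
  obtain rfl : y₂ = y := hy2
  obtain ⟨⟨x'', y₃⟩, h3, p3, hy3, n3⟩ := hsnd _ h1 p1
  obtain rfl : y₃ = y' := hy3
  obtain ⟨⟨x₄, y''⟩, h4, p4, hx4, n4⟩ := hfst _ h2 p2
  obtain rfl : x₄ = x' := hx4
  have hy : y₂ ≠ y₃ := fun h => n1 (by rw [h])
  have hx : x₁ ≠ x₄ := fun h => n2 (by rw [h])
  have hx' : x'' ≠ x₁ := fun h => n3 (by rw [h])
  have hy' : y'' ≠ y₂ := fun h => n4 (by rw [h])
  have hsub : ({(x₁, y₂), (x₁, y₃), (x₄, y₂), (x'', y₃)} : Finset (α × β)) ⊆ S := by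
    simp [Finset.insert_subset_iff, *]
  have hcard : ({(x₁, y₂), (x₁, y₃), (x₄, y₂), (x'', y₃)} : Finset (α × β)).card = 4 := by
    rw [Finset.card_insert_of_notMem, Finset.card_insert_of_notMem,
      Finset.card_insert_of_notMem, Finset.card_singleton] <;>
      simp [hy, hx, hx'.symm]
  rw [← Finset.eq_of_subset_of_card_le hsub (by omega)] at h4
  simp only [Finset.mem_insert, Finset.mem_singleton, Prod.mk.injEq] at h4
  obtain ⟨rfl, -⟩ : x₄ = x'' ∧ y'' = y₃ := by
    rcases h4 with h | h | h | h
    · exact absurd h.1.symm hx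
    · exact absurd h.1.symm hx
    · exact absurd h.2 hy'
    · exact h
  exact ⟨x₁, x₄, y₂, y₃, hx, hy, he, h1, h2, h3⟩

/-- The pair of cubic moment vectors of `x` and `y`, sharing their constant coordinate. -/
def cubicVec {F : Type} [Field F] (p : F × F) : Fin (6 + 1) → F :=
  ![1, p.1, p.1 ^ 2, p.1 ^ 3, p.2, p.2 ^ 2, p.2 ^ 3]

theorem cubicVec_ne_zero {F : Type} [Field F] (p : F × F) : cubicVec p ≠ 0 := fun h => by
  simpa [cubicVec] using congrFun h 0

theorem span_cubicVec_injective {F : Type} [Field F] :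
    Function.Injective fun p : F × F => Submodule.span F {cubicVec p} := by
  intro p p' h
  have hmem : cubicVec p ∈ Submodule.span F {cubicVec p'} :=
    h.le (Submodule.mem_span_singleton_self _)
  obtain ⟨k, hk⟩ := Submodule.mem_span_singleton.1 hmem
  have h0 : k = 1 := by simpa [cubicVec] using congrFun hk 0
  subst h0
  rw [one_smul] at hk
  exact Prod.ext (congrFun hk 1).symm (congrFun hk 4).symm

theorem linearIndepOn_cubicVec {F : Type} [Field F] {S : Finset (F × F)} (hS : S.card ≤ 4)
    (hC4 : ¬ ∃ x x' y y' : F, x ≠ x' ∧ y ≠ y' ∧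
      (x, y) ∈ S ∧ (x, y') ∈ S ∧ (x', y) ∈ S ∧ (x', y') ∈ S) :
    LinearIndepOn F cubicVec (S : Set (F × F)) := by
  classical
  rw [linearIndepOn_finset_iff]
  intro c hc e he
  by_contra hce
  have hcoord (j : Fin (6 + 1)) : ∑ p ∈ S, c p * cubicVec p j = 0 := by
    simpa [Finset.sum_apply] using congrFun hc j
  have hfst := sum_fiber_eq_zero_of_moments_eq_zero S hS c Prod.fst fun k hk => by
    interval_cases k
    · simpa [cubicVec] using hcoord 0
    · simpa [cubicVec] using hcoord 1
    · simpa [cubicVec] using hcoord 2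
    · simpa [cubicVec] using hcoord 3
  have hsnd := sum_fiber_eq_zero_of_moments_eq_zero S hS c Prod.snd fun k hk => by
    interval_cases k
    · simpa [cubicVec] using hcoord 0
    · simpa [cubicVec] using hcoord 4
    · simpa [cubicVec] using hcoord 5
    · simpa [cubicVec] using hcoord 6
  exact hC4 (exists_four_cycle hS (p := fun e => c e ≠ 0)
    (fun _ => exists_ne_of_sum_fiber_eq_zero hfst)
    (fun _ => exists_ne_of_sum_fiber_eq_zero hsnd) he hce)

theorem c4free_gives_three_two_set (q : ℕ) (F : Type) [Field F] [Fintype F]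
    (hF : Fintype.card F = q) (G : Set (F × F))
    (hG : ¬ ∃ x x' y y' : F, x ≠ x' ∧ y ≠ y' ∧
      (x, y) ∈ G ∧ (x, y') ∈ G ∧ (x', y) ∈ G ∧ (x', y') ∈ G)
    (X' : Set (Submodule F (Fin (6 + 1) → F)))
    (hX' : X' = (fun p : F × F =>
      Submodule.span F {![1, p.1, p.1 ^ 2, p.1 ^ 3, p.2, p.2 ^ 2, p.2 ^ 3]}) '' G) :
    X'.ncard = G.ncard ∧ IsRSSet F 6 3 2 X' := by
  change X' = (fun p : F × F => Submodule.span F {cubicVec p}) '' G at hX'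
  subst hX'
  refine ⟨Set.ncard_image_of_injective G span_cubicVec_injective, ?_, fun W hW => ?_⟩
  · rintro _ ⟨p, -, rfl⟩
    exact finrank_span_singleton (cubicVec_ne_zero p)
  · have himg : {P ∈ (fun p : F × F => Submodule.span F {cubicVec p}) '' G | P ≤ W} =
        (fun p : F × F => Submodule.span F {cubicVec p}) '' {p ∈ G | cubicVec p ∈ W} := by
      ext P
      constructor
      · rintro ⟨⟨p, hp, rfl⟩, hPW⟩
        exact ⟨p, ⟨hp, (Submodule.span_singleton_le_iff_mem _ _).1 hPW⟩, rfl⟩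
      · rintro ⟨p, ⟨hp, hpW⟩, rfl⟩
        exact ⟨⟨p, hp, rfl⟩, (Submodule.span_singleton_le_iff_mem _ _).2 hpW⟩
    rw [himg, Set.ncard_image_of_injective _ span_cubicVec_injective]
    by_contra! hlt
    obtain ⟨T, hT, hTcard⟩ := Set.exists_subset_card_eq (Nat.succ_le_of_lt hlt)
    obtain ⟨S, rfl⟩ := T.toFinite.exists_finset_coe
    rw [Set.ncard_coe_finset] at hTcard
    have hind : LinearIndepOn F cubicVec (S : Set (F × F)) := by
      refine linearIndepOn_cubicVec hTcard.le ?_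
      rintro ⟨x, x', y, y', hx, hy, h1, h2, h3, h4⟩
      exact hG ⟨x, x', y, y', hx, hy, (hT h1).1, (hT h2).1, (hT h3).1, (hT h4).1⟩
    have hindW : LinearIndependent F fun p : S => (⟨cubicVec p.1, (hT p.2).2⟩ : W) :=
      LinearIndependent.of_comp W.subtype hind
    have hle := hindW.fintype_card_le_finrank
    rw [Fintype.card_coe, hW] at hle
    omega
end

section
/- Let q₀ be a prime power and q = q₀². Then there exists a (3, 2)-set in PG(6, q) of size q₀³ = q^(3/2); that is, a set of q₀³ points of PG(6, q) such that no plane of PG(6, q) contains more than 3 of them. -/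
/-- The points `(1, a, a², a³)` of `F × K × K × K`, for distinct `a`, are in general position:
any four of them are linearly independent over `F`. -/
theorem linearIndependent_twistedCubic {F K : Type*} [Field F] [Field K] [Algebra F K]
    {a : Fin 4 → K} (ha : Function.Injective a) :
    LinearIndependent F fun i => ((1, a i, a i ^ 2, a i ^ 3) : F × K × K × K) := by
  let φ : F × K × K × K →ₗ[F] Fin 4 → K :=
    { toFun := fun p => ![algebraMap F K p.1, p.2.1, p.2.2.1, p.2.2.2]
      map_add' := fun p r => by ext i; fin_cases i <;> simp
      map_smul' := fun c p => by ext i; fin_cases i <;> simp [Algebra.smul_def] }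
  refine LinearIndependent.of_comp φ ?_
  have hV : LinearIndependent K (Matrix.vandermonde a).row :=
    Matrix.linearIndependent_rows_of_det_ne_zero (Matrix.det_vandermonde_ne_zero_iff.2 ha)
  convert hV.restrict_scalars' F using 1
  ext i j
  fin_cases j <;> simp [φ, Matrix.vandermonde]

/-- If any four vectors of an injective family are linearly independent, then a subspace of
dimension at most three contains at most three of the points they span. -/
theorem ncard_span_singleton_le_three {F V ι : Type*} [Field F] [AddCommGroup V] [Module F V]
    [FiniteDimensional F V] [Finite ι] {v : ι → V}
    (hv : ∀ a : Fin 4 → ι, Function.Injective a → LinearIndependent F (v ∘ a))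
    (S : Set ι) {W : Submodule F V} (hW : Module.finrank F W ≤ 3) :
    {P ∈ (fun i => F ∙ v i) '' S | P ≤ W}.ncard ≤ 3 := by
  have hT : {i | v i ∈ W}.ncard ≤ 3 := by
    by_contra! h
    obtain ⟨T, hTW, hT⟩ := Set.exists_subset_card_eq (Nat.succ_le_of_lt h)
    have hcard : Nat.card T = 4 := hT
    let a : Fin 4 ≃ T := (Finite.equivFinOfCardEq hcard).symm
    have hli := hv (fun i => a i) (Subtype.val_injective.comp a.injective)
    have hliW : LinearIndependent F fun i => (⟨v (a i), hTW (a i).2⟩ : W) :=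
      LinearIndependent.of_comp W.subtype hli
    have := hliW.fintype_card_le_finrank
    rw [Fintype.card_fin] at this
    omega
  refine (Set.ncard_le_ncard (t := (fun i => F ∙ v i) '' {i | v i ∈ W}) ?_
    (Set.toFinite _)).trans ((Set.ncard_image_le (Set.toFinite _)).trans hT)
  rintro _ ⟨⟨i, -, rfl⟩, hi⟩
  exact ⟨i, (Submodule.span_singleton_le_iff_mem _ _).1 hi, rfl⟩

/-- Every set of elements of a quadratic extension `K` of `F` gives a `(3, 2)`-set of the same
size in `PG(6, F)`, consisting of the points `(1, a, a², a³)` of `F × K × K × K ≃ F^7`. -/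
theorem exists_isRSSet_ncard_eq {F : Type} {K : Type*} [Field F] [Field K] [Algebra F K] [Finite K]
    (hK : Module.finrank F K = 2) (S : Set K) :
    ∃ X : Set (Submodule F (Fin (6 + 1) → F)), IsRSSet F 6 3 2 X ∧ X.ncard = S.ncard := by
  have : Module.Finite F K := .of_finite
  let e : (F × K × K × K) ≃ₗ[F] (Fin (6 + 1) → F) :=
    LinearEquiv.ofFinrankEq _ _ (by simp [hK])
  let v : K → Fin (6 + 1) → F := fun a => e (1, a, a ^ 2, a ^ 3)
  have hv0 (a : K) : v a ≠ 0 := fun h => by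
    simpa using congrArg Prod.fst (e.map_eq_zero_iff.1 h)
  have hinj : Function.Injective fun a => F ∙ v a := fun a b (hab : F ∙ v a = F ∙ v b) => by
    obtain ⟨c, hc⟩ := Submodule.mem_span_singleton.1
      (show v a ∈ F ∙ v b from hab ▸ Submodule.mem_span_singleton_self _)
    have h : c • ((1, b, b ^ 2, b ^ 3) : F × K × K × K) = (1, a, a ^ 2, a ^ 3) :=
      e.injective ((e.map_smul c _).trans hc)
    simp only [Prod.smul_mk, Prod.mk.injEq, smul_eq_mul, mul_one] at h
    obtain ⟨rfl, h, -⟩ := h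
    simpa using h.symm
  refine ⟨(fun a => F ∙ v a) '' S, ⟨?_, fun W hW => ?_⟩, Set.ncard_image_of_injective _ hinj⟩
  · rintro _ ⟨a, -, rfl⟩
    exact finrank_span_singleton (hv0 a)
  · refine ncard_span_singleton_le_three (fun a ha => ?_) S hW.le
    have h := linearIndependent_twistedCubic (F := F) ha
    exact h.map' (e : (F × K × K × K) →ₗ[F] Fin (6 + 1) → F) e.ker

/-- For `q = q₀²` a square prime power, there is a `(3, 2)`-set of size `q₀³ = q^(3/2)`
in `PG(6, q)`. -/
theorem exists_three_two_set_square (q₀ : ℕ) (F : Type) [Field F] [Fintype F]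
    (hF : Fintype.card F = q₀ ^ 2) :
    ∃ X : Set (Submodule F (Fin (6 + 1) → F)),
      IsRSSet F 6 3 2 X ∧ X.ncard = q₀ ^ 3 := by
  obtain ⟨p, hp⟩ := CharP.exists F
  have : Fact p.Prime := ⟨CharP.char_is_prime F p⟩
  have hKcard : Nat.card (FiniteField.Extension F p 2) = q₀ ^ 4 := by
    rw [FiniteField.natCard_extension, Nat.card_eq_fintype_card, hF, ← pow_mul]
  have hq : 0 < q₀ := Nat.pos_of_ne_zero fun h => by simp [h] at hF
  have hle : q₀ ^ 3 ≤ (Set.univ : Set (FiniteField.Extension F p 2)).ncard := by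
    rw [Set.ncard_univ, hKcard]
    exact Nat.pow_le_pow_right hq (by norm_num)
  obtain ⟨S, -, hS⟩ := Set.exists_subset_card_eq hle
  rw [← hS]
  exact exists_isRSSet_ncard_eq (FiniteField.finrank_extension F p 2) S
end

section
/- For every ε > 0 there exists q₀ such that for every prime power q ≥ q₀ there exists a (3, 2)-set in PG(6, q) of size at least (1 - ε) · q^(3/2); that is, a set of at least (1 - ε) q^(3/2) points of PG(6, q) with no 4 of them in a common plane. -/
open Module

/-- The moment curve `a ↦ (1, a, a², a³)` with values in `F × K³`. -/
def momentCurve (F : Type*) {K : Type*} [Field F] [Field K] (a : K) : F × K × K × K :=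
  (1, a, a ^ 2, a ^ 3)

theorem momentCurve_ne_zero {F K : Type*} [Field F] [Field K] (a : K) :
    momentCurve F a ≠ 0 := by
  simp [momentCurve]

section momentCurve

variable {F K V : Type*} [Field F] [Field K] [Algebra F K] [AddCommGroup V] [Module F V]

/-- The inclusion of `F × K³` into `K⁴`. -/
def prodInclusion (F K : Type*) [Field F] [Field K] [Algebra F K] :
    (F × K × K × K) →ₗ[F] (Fin 4 → K) where
  toFun x := ![algebraMap F K x.1, x.2.1, x.2.2.1, x.2.2.2]
  map_add' x y := by
    ext i
    fin_cases i <;> simp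
  map_smul' c x := by
    ext i
    fin_cases i <;> simp [Algebra.smul_def]

theorem prodInclusion_momentCurve (a : K) :
    prodInclusion F K (momentCurve F a) = fun j : Fin 4 => a ^ (j : ℕ) := by
  ext i
  fin_cases i <;> simp [prodInclusion, momentCurve]

theorem linearIndependent_momentCurve {g : Fin 4 → K} (hg : Function.Injective g) :
    LinearIndependent F fun i => momentCurve F (g i) := by
  apply LinearIndependent.of_comp (prodInclusion F K)
  have h : LinearIndependent K (Matrix.vandermonde g).row :=
    Matrix.linearIndependent_rows_of_det_ne_zero (Matrix.det_vandermonde_ne_zero_iff.mpr hg)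
  convert h.restrict_scalars' F using 1
  funext i
  exact prodInclusion_momentCurve (g i)

theorem span_momentCurve_injective (e : (F × K × K × K) ≃ₗ[F] V) :
    Function.Injective fun a : K => Submodule.span F {e (momentCurve F a)} := by
  intro a b hab
  have h : e (momentCurve F a) ∈ Submodule.span F {e (momentCurve F b)} := by
    rw [← show _ = Submodule.span F {e (momentCurve F b)} from hab]
    exact Submodule.mem_span_singleton_self _
  obtain ⟨c, hc⟩ := Submodule.mem_span_singleton.mp h
  rw [← map_smul] at hc
  have hc' := e.injective hc
  simp only [momentCurve, Prod.smul_mk, Prod.mk.injEq, smul_eq_mul, mul_one] at hc'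
  simpa [hc'.1] using hc'.2.1.symm

theorem four_le_finrank_of_momentCurve_mem (e : (F × K × K × K) ≃ₗ[F] V)
    {W : Submodule F V} [Module.Finite F W] {g : Fin 4 → K} (hg : Function.Injective g)
    (hgW : ∀ i, e (momentCurve F (g i)) ∈ W) : 4 ≤ finrank F W := by
  have hli : LinearIndependent F fun i => e (momentCurve F (g i)) :=
    (linearIndependent_momentCurve (F := F) hg).map' e.toLinearMap e.ker
  have hliW : LinearIndependent F fun i => (⟨e (momentCurve F (g i)), hgW i⟩ : W) :=
    LinearIndependent.of_comp W.subtype hli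
  simpa using hliW.fintype_card_le_finrank

theorem ncard_span_momentCurve_le_three [Finite K] (e : (F × K × K × K) ≃ₗ[F] V)
    {W : Submodule F V} (hW : finrank F W = 3) :
    {P ∈ Set.range fun a : K => Submodule.span F {e (momentCurve F a)} | P ≤ W}.ncard ≤ 3 := by
  have : Module.Finite F W := finite_of_finrank_pos (hW ▸ Nat.succ_pos 2)
  have hS : {P ∈ Set.range fun a : K => Submodule.span F {e (momentCurve F a)} | P ≤ W} ⊆
      (fun a : K => Submodule.span F {e (momentCurve F a)}) ''
        {a | e (momentCurve F a) ∈ W} := by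
    rintro _ ⟨⟨a, rfl⟩, ha⟩
    exact ⟨a, ha (Submodule.mem_span_singleton_self _), rfl⟩
  refine (Set.ncard_le_ncard hS).trans ((Set.ncard_image_le (Set.toFinite _)).trans ?_)
  by_contra! hcard
  obtain ⟨T, hTS, hT⟩ := Set.exists_subset_card_eq (Nat.succ_le_of_lt hcard)
  obtain ⟨g⟩ : Nonempty (Fin 4 ≃ T) :=
    ⟨(Finite.equivFinOfCardEq ((Nat.card_coe_set_eq T).trans hT)).symm⟩
  have hle := four_le_finrank_of_momentCurve_mem e
    (Subtype.val_injective.comp g.injective) fun i => hTS (g i).2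
  exact absurd (hW ▸ hle) (by norm_num)

end momentCurve

theorem exists_isRSSet_ncard_eq_sq (F : Type) [Field F] [Finite F] :
    ∃ X : Set (Submodule F (Fin (6 + 1) → F)),
      IsRSSet F 6 3 2 X ∧ X.ncard = Nat.card F ^ 2 := by
  obtain ⟨p, hp⟩ := CharP.exists F
  have : Fact p.Prime := ⟨CharP.char_is_prime F p⟩
  let K := FiniteField.Extension F p 2
  have hK : finrank F K = 2 := FiniteField.finrank_extension F p 2
  have hfin : finrank F (F × K × K × K) = finrank F (Fin (6 + 1) → F) := by
    simp [hK]
  let e := LinearEquiv.ofFinrankEq _ _ hfin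
  refine ⟨Set.range fun a : K => Submodule.span F {e (momentCurve F a)}, ⟨?_, ?_⟩, ?_⟩
  · rintro _ ⟨a, rfl⟩
    exact finrank_span_singleton (e.map_ne_zero_iff.mpr (momentCurve_ne_zero a))
  · intro W hW
    exact ncard_span_momentCurve_le_three e hW
  · rw [← Set.image_univ, Set.ncard_image_of_injective _ (span_momentCurve_injective e),
      Set.ncard_univ]
    exact FiniteField.natCard_extension F p 2

/-- For `q` large enough there is a `(3, 2)`-set of size at least `(1 - ε) q^(3/2)`
in `PG(6, q)`. -/
theorem exists_large_three_two_set (ε : ℝ) (hε : 0 < ε) :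
    ∃ q₀ : ℕ, ∀ (q : ℕ), q₀ ≤ q → ∀ (F : Type) [Field F] [Fintype F],
      Fintype.card F = q →
        ∃ X : Set (Submodule F (Fin (6 + 1) → F)),
          IsRSSet F 6 3 2 X ∧ (1 - ε) * (q : ℝ) ^ ((3 : ℝ) / 2) ≤ (X.ncard : ℝ) := by
  refine ⟨1, fun q hq F _ _ hF => ?_⟩
  obtain ⟨X, hX, hcard⟩ := exists_isRSSet_ncard_eq_sq F
  refine ⟨X, hX, ?_⟩
  rw [hcard, Nat.card_eq_fintype_card, hF]
  have hq' : (1 : ℝ) ≤ q := by exact_mod_cast hq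
  calc (1 - ε) * (q : ℝ) ^ ((3 : ℝ) / 2) ≤ 1 * (q : ℝ) ^ ((3 : ℝ) / 2) := by
        gcongr
        linarith
    _ ≤ (q : ℝ) ^ (2 : ℝ) := by
        rw [one_mul]
        exact Real.rpow_le_rpow_of_exponent_le hq' (by norm_num)
    _ = ((q ^ 2 : ℕ) : ℝ) := by
        rw [Real.rpow_two, Nat.cast_pow]
end

section
/- Let m ≥ 2 be an integer and n = 2m - 1. For every ε > 0 there exists q₀ such that for every prime power q ≥ q₀ there exists a (4, 2)-set in PG(n, q) of size at least (1 - ε) · q^((n-1)/2) = (1 - ε) · q^(m-1); that is, a set of at least (1 - ε) q^(m-1) points of PG(n, q) such that no plane contains more than 4 of them. -/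
section Curve

variable {L : Type*} [Field L] (σ : L →+* L)

theorem mul_map_eq_of_relation {x y z x' y' z' α β γ : L}
    (hx : x * x' = σ x ^ 2) (hy : y * y' = σ y ^ 2) (hz : z * z' = σ z ^ 2)
    (hσα : σ α = α) (hσβ : σ β = β) (hσγ : σ γ = γ) (hα : α ≠ 0) (hβ : β ≠ 0)
    (h : α * x + β * y + γ * z = 0) (h' : α * x' + β * y' + γ * z' = 0) :
    x * σ y = y * σ x := by
  have hσ : α * σ x + β * σ y + γ * σ z = 0 := by
    have := congrArg σ h
    simpa [hσα, hσβ, hσγ] using this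
  have e1 : (α * β) * (x * y' + y * x' - 2 * σ x * σ y) = 0 := by
    have hz1 : γ * z = -(α * x + β * y) := by linear_combination h
    have hz2 : γ * z' = -(α * x' + β * y') := by linear_combination h'
    have hz3 : γ * σ z = -(α * σ x + β * σ y) := by linear_combination hσ
    have e : (γ * z) * (γ * z') = (γ * σ z) ^ 2 := by linear_combination γ ^ 2 * hz
    rw [hz1, hz2, hz3] at e
    linear_combination e - α ^ 2 * hx - β ^ 2 * hy
  have e2 := (mul_eq_zero.mp e1).resolve_left (mul_ne_zero hα hβ)
  have e3 : (x * σ y - y * σ x) ^ 2 = 0 := by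
    linear_combination x * y * e2 - x ^ 2 * hy - y ^ 2 * hx
  exact sub_eq_zero.mp (pow_eq_zero_iff two_ne_zero |>.mp e3)

theorem not_proportional_polar {x y z α β γ k : L} (hx : x ≠ 0) (hy : y ≠ 0)
    (hxy : x * σ y ≠ y * σ x) (hyz : y * σ z ≠ z * σ y) (hzx : z * σ x ≠ x * σ z)
    (hσα : σ α = α) (hσβ : σ β = β) (hσγ : σ γ = γ)
    (h1 : (y * σ z - z * σ y) ^ 2 * x = α * k)
    (h2 : (z * σ x - x * σ z) ^ 2 * y = β * k)
    (h3 : (x * σ y - y * σ x) ^ 2 * z = γ * k) : False := by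
  obtain ⟨A, hA⟩ : ∃ A, A = y * σ z - z * σ y := ⟨_, rfl⟩
  obtain ⟨B, hB⟩ : ∃ B, B = z * σ x - x * σ z := ⟨_, rfl⟩
  obtain ⟨C, hC⟩ : ∃ C, C = x * σ y - y * σ x := ⟨_, rfl⟩
  have r1 : A * x + B * y + C * z = 0 := by rw [hA, hB, hC]; ring
  have r2 : A * σ x + B * σ y + C * σ z = 0 := by rw [hA, hB, hC]; ring
  have hA0 : A ≠ 0 := hA ▸ sub_ne_zero.mpr hyz
  have hB0 : B ≠ 0 := hB ▸ sub_ne_zero.mpr hzx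
  have hC0 : C ≠ 0 := hC ▸ sub_ne_zero.mpr hxy
  rw [← hA] at h1
  rw [← hB] at h2
  rw [← hC] at h3
  have hk : k ≠ 0 := by
    rintro rfl
    simp [hA0, hx] at h1
  have hα : α ≠ 0 := by
    rintro rfl
    simp [hA0, hx] at h1
  have hβ : β ≠ 0 := by
    rintro rfl
    simp [hB0, hy] at h2
  have g1 : σ A ^ 2 * σ x = α * σ k := by simpa [hσα] using congrArg σ h1
  have g2 : σ B ^ 2 * σ y = β * σ k := by simpa [hσβ] using congrArg σ h2
  have g3 : σ C ^ 2 * σ z = γ * σ k := by simpa [hσγ] using congrArg σ h3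
  have hσk : σ k ≠ 0 := (map_ne_zero σ).mpr hk
  have hσA : σ A ≠ 0 := (map_ne_zero σ).mpr hA0
  have hσB : σ B ≠ 0 := (map_ne_zero σ).mpr hB0
  have hσC : σ C ≠ 0 := (map_ne_zero σ).mpr hC0
  have s1 : α * A⁻¹ + β * B⁻¹ + γ * C⁻¹ = 0 := by
    have : k * (α * A⁻¹ + β * B⁻¹ + γ * C⁻¹) = 0 := by
      have e1 : k * (α * A⁻¹) = A * x := by field_simp; linear_combination -h1
      have e2 : k * (β * B⁻¹) = B * y := by field_simp; linear_combination -h2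
      have e3 : k * (γ * C⁻¹) = C * z := by field_simp; linear_combination -h3
      rw [mul_add, mul_add, e1, e2, e3, r1]
    exact (mul_eq_zero.mp this).resolve_left hk
  have s2 : α * (A * (σ A ^ 2)⁻¹) + β * (B * (σ B ^ 2)⁻¹) + γ * (C * (σ C ^ 2)⁻¹) = 0 := by
    have : σ k * (α * (A * (σ A ^ 2)⁻¹) + β * (B * (σ B ^ 2)⁻¹) + γ * (C * (σ C ^ 2)⁻¹)) = 0 := by
      have e1 : σ k * (α * (A * (σ A ^ 2)⁻¹)) = A * σ x := by
        field_simp; linear_combination -g1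
      have e2 : σ k * (β * (B * (σ B ^ 2)⁻¹)) = B * σ y := by
        field_simp; linear_combination -g2
      have e3 : σ k * (γ * (C * (σ C ^ 2)⁻¹)) = C * σ z := by
        field_simp; linear_combination -g3
      rw [mul_add, mul_add, e1, e2, e3, r2]
    exact (mul_eq_zero.mp this).resolve_left hσk
  have hAB := mul_map_eq_of_relation σ
    (by rw [map_inv₀]; field_simp) (by rw [map_inv₀]; field_simp) (by rw [map_inv₀]; field_simp)
    hσα hσβ hσγ hα hβ s1 s2
  rw [map_inv₀, map_inv₀] at hAB
  have hAB' : B * σ A = A * σ B := by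
    field_simp at hAB
    linear_combination hAB
  apply hxy
  have hne : A ^ 2 * σ B ^ 2 ≠ 0 := mul_ne_zero (pow_ne_zero _ hA0) (pow_ne_zero _ hσB)
  apply mul_left_cancel₀ hne
  calc A ^ 2 * σ B ^ 2 * (x * σ y) = (A ^ 2 * x) * (σ B ^ 2 * σ y) := by ring
    _ = (B ^ 2 * y) * (σ A ^ 2 * σ x) := by rw [h1, g2, h2, g1]; ring
    _ = (B * σ A) ^ 2 * (y * σ x) := by ring
    _ = A ^ 2 * σ B ^ 2 * (y * σ x) := by rw [hAB']; ring

/-- The second coordinate of the point over `x` of the curve `x * y = σ x ^ 2`. -/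
def frobeniusCurve (x : L) : L := σ x ^ 2 * x⁻¹

theorem mul_frobeniusCurve (x : L) : x * frobeniusCurve σ x = σ x ^ 2 := by
  unfold frobeniusCurve
  by_cases hx : x = 0
  · simp [hx]
  · field_simp

theorem coeff_eq_zero_of_curve_relation {x y z a b c : L} (hx : x ≠ 0)
    (hxy : x * σ y ≠ y * σ x) (hxz : x * σ z ≠ z * σ x)
    (hσa : σ a = a) (hσb : σ b = b) (hσc : σ c = c)
    (h : a * x + b * y + c * z = 0)
    (h' : a * frobeniusCurve σ x + b * frobeniusCurve σ y + c * frobeniusCurve σ z = 0) :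
    a = 0 := by
  by_contra ha
  have mx := mul_frobeniusCurve σ x
  have my := mul_frobeniusCurve σ y
  have mz := mul_frobeniusCurve σ z
  have hb : b = 0 := by
    by_contra hb
    exact hxy (mul_map_eq_of_relation σ mx my mz hσa hσb hσc ha hb h h')
  have hc : c = 0 := by
    by_contra hc
    exact hxz (mul_map_eq_of_relation σ mx mz my hσa hσc hσb ha hc
      (by linear_combination h) (by linear_combination h'))
  simp [hb, hc, ha, hx] at h

theorem coeff_ne_zero_of_mem_curve_span {x y z t a b c : L} (ht : t ≠ 0)
    (hty : t * σ y ≠ y * σ t) (htz : t * σ z ≠ z * σ t)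
    (hσb : σ b = b) (hσc : σ c = c)
    (h : a * x + b * y + c * z = t)
    (h' : a * frobeniusCurve σ x + b * frobeniusCurve σ y + c * frobeniusCurve σ z =
      frobeniusCurve σ t) : a ≠ 0 := by
  rintro rfl
  have := coeff_eq_zero_of_curve_relation σ (a := -1) ht hty htz (by simp) hσb hσc
    (by linear_combination h) (by linear_combination h')
  simp at this

theorem polar_relation {x y z t x' y' z' t' a b c : L}
    (hx : x * x' = σ x ^ 2) (hy : y * y' = σ y ^ 2) (hz : z * z' = σ z ^ 2)
    (ht : t * t' = σ t ^ 2)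
    (hσa : σ a = a) (hσb : σ b = b) (hσc : σ c = c)
    (h : a * x + b * y + c * z = t) (h' : a * x' + b * y' + c * z' = t') :
    b * c * (y * z' + z * y' - 2 * σ y * σ z) + c * a * (z * x' + x * z' - 2 * σ z * σ x) +
      a * b * (x * y' + y * x' - 2 * σ x * σ y) = 0 := by
  have hσ : σ t = a * σ x + b * σ y + c * σ z := by
    rw [← h]; simp [hσa, hσb, hσc]
  rw [hσ, ← h, ← h'] at ht
  linear_combination ht - a ^ 2 * hx - b ^ 2 * hy - c ^ 2 * hz

theorem polar_mul {x y x' y' : L} (hx : x * x' = σ x ^ 2) (hy : y * y' = σ y ^ 2) :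
    (x * y' + y * x' - 2 * σ x * σ y) * (x * y) = (x * σ y - y * σ x) ^ 2 := by
  linear_combination x ^ 2 * hy + y ^ 2 * hx

/-- Two further points of the curve in the plane spanned by three points of it agree. -/
theorem mul_map_eq_of_mem_curve_plane {x y z t s a b c d e f : L}
    (hx : x ≠ 0) (hy : y ≠ 0) (hz : z ≠ 0) (ht : t ≠ 0) (hs : s ≠ 0)
    (hxy : x * σ y ≠ y * σ x) (hyz : y * σ z ≠ z * σ y) (hzx : z * σ x ≠ x * σ z)
    (hxt : x * σ t ≠ t * σ x) (hyt : y * σ t ≠ t * σ y) (hzt : z * σ t ≠ t * σ z)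
    (hxs : x * σ s ≠ s * σ x) (hys : y * σ s ≠ s * σ y) (hzs : z * σ s ≠ s * σ z)
    (hσa : σ a = a) (hσb : σ b = b) (hσc : σ c = c)
    (hσd : σ d = d) (hσe : σ e = e) (hσf : σ f = f)
    (h : a * x + b * y + c * z = t)
    (h' : a * frobeniusCurve σ x + b * frobeniusCurve σ y + c * frobeniusCurve σ z =
      frobeniusCurve σ t)
    (g : d * x + e * y + f * z = s)
    (g' : d * frobeniusCurve σ x + e * frobeniusCurve σ y + f * frobeniusCurve σ z =
      frobeniusCurve σ s) : t * σ s = s * σ t := by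
  have ha := coeff_ne_zero_of_mem_curve_span σ ht hyt.symm hzt.symm hσb hσc h h'
  have hd := coeff_ne_zero_of_mem_curve_span σ hs hys.symm hzs.symm hσe hσf g g'
  have hb := coeff_ne_zero_of_mem_curve_span σ (x := y) (y := x) (a := b) (b := a) ht hxt.symm
    hzt.symm hσa hσc (by linear_combination h) (by linear_combination h')
  have he := coeff_ne_zero_of_mem_curve_span σ (x := y) (y := x) (a := e) (b := d) hs hxs.symm
    hzs.symm hσd hσf (by linear_combination g) (by linear_combination g')
  have hc := coeff_ne_zero_of_mem_curve_span σ (x := z) (y := x) (z := y) (a := c) (b := a) (c := b)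
    ht hxt.symm hyt.symm hσa hσb (by linear_combination h) (by linear_combination h')
  have mx := mul_frobeniusCurve σ x
  have my := mul_frobeniusCurve σ y
  have mz := mul_frobeniusCurve σ z
  have E1 := polar_relation σ mx my mz (mul_frobeniusCurve σ t) hσa hσb hσc h h'
  have E2 := polar_relation σ mx my mz (mul_frobeniusCurve σ s) hσd hσe hσf g g'
  have U := polar_mul σ my mz
  have V := polar_mul σ mz mx
  have W := polar_mul σ mx my
  generalize y * frobeniusCurve σ z + z * frobeniusCurve σ y - 2 * σ y * σ z = u at *
  generalize z * frobeniusCurve σ x + x * frobeniusCurve σ z - 2 * σ z * σ x = v at *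
  generalize x * frobeniusCurve σ y + y * frobeniusCurve σ x - 2 * σ x * σ y = w at *
  have hu : u ≠ 0 := by
    rintro rfl
    rw [zero_mul] at U
    exact hyz (sub_eq_zero.mp (pow_eq_zero_iff two_ne_zero |>.mp U.symm))
  obtain ⟨p, hp⟩ : ∃ p, p = a * d * (c * e - b * f) := ⟨_, rfl⟩
  obtain ⟨q, hq⟩ : ∃ q, q = b * e * (a * f - c * d) := ⟨_, rfl⟩
  obtain ⟨r, hr⟩ : ∃ r, r = c * f * (b * d - a * e) := ⟨_, rfl⟩
  have hv : v * p = u * q := by rw [hp, hq]; linear_combination d * e * E1 - a * b * E2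
  have hw : w * p = u * r := by rw [hp, hr]; linear_combination a * c * E2 - d * f * E1
  by_cases hp0 : p = 0
  · have hq0 : q = 0 := by simpa [hp0, hu] using hv.symm
    have hce : c * e = b * f := by
      rw [hp0] at hp
      simpa [ha, hd, sub_eq_zero] using hp.symm
    have haf : a * f = c * d := by
      rw [hq0] at hq
      simpa [hb, he, sub_eq_zero] using hq.symm
    have hbd : b * d = a * e := by
      apply mul_left_cancel₀ hc
      linear_combination (-b) * haf - a * hce
    have hst : a * s = d * t := by
      rw [← g, ← h]; linear_combination (-y) * hbd + z * haf
    have hσst : a * σ s = d * σ t := by simpa [hσa, hσd] using congrArg σ hst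
    apply mul_left_cancel₀ ha
    linear_combination t * hσst - σ t * hst
  · exfalso
    refine not_proportional_polar σ (α := p) (β := q) (γ := r) (k := u * p⁻¹ * (x * y * z))
      hx hy hxy hyz hzx (by simp [hp, hσa, hσb, hσc, hσd, hσe, hσf])
      (by simp [hq, hσa, hσb, hσc, hσd, hσe, hσf])
      (by simp [hr, hσa, hσb, hσc, hσd, hσe, hσf]) ?_ ?_ ?_
    · rw [← U]; field_simp
    · rw [← V]; field_simp; linear_combination hv
    · rw [← W]; field_simp; linear_combination hw

end Curve

theorem exists_algebraMap_eq_of_frobenius_eq {F L : Type*} [Field F] [Fintype F] [Field L]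
    [Finite L] [Algebra F L] {x : L}
    (hx : FiniteField.frobeniusAlgHom F L x = x) : ∃ c : F, algebraMap F L c = x := by
  have : FiniteDimensional F L := Module.Finite.of_finite
  have := (IsGalois.mem_range_algebraMap_iff_fixed (F := F) x).mpr (fun f => by
    obtain ⟨n, rfl⟩ := (FiniteField.bijective_frobeniusAlgEquivOfAlgebraic_pow F L).2 f
    rw [AlgEquiv.coe_pow]
    exact Function.iterate_fixed hx _)
  exact this

theorem exists_finite_extension (F : Type) [Field F] [Fintype F] (k : ℕ) :
    ∃ (L : Type) (_ : Field L) (_ : Finite L) (_ : Algebra F L), Module.finrank F L = k + 1 := by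
  obtain ⟨p, hp⟩ := CharP.exists F
  have : Fact p.Prime := ⟨CharP.char_is_prime F p⟩
  exact ⟨FiniteField.Extension F p (k + 1), inferInstance, inferInstance, inferInstance,
    FiniteField.finrank_extension F p (k + 1)⟩

section Points

variable {F L : Type*} [Field F] [Fintype F] [Field L] [Algebra F L]

local notation "φ" => (FiniteField.frobeniusAlgHom F L : L →+* L)

theorem map_algebraMap_frobenius (c : F) : φ (algebraMap F L c) = algebraMap F L c :=
  (FiniteField.frobeniusAlgHom F L).commutes c

/-- The vector representing the point over `x` of the curve `x * y = σ x ^ 2`, for `σ` the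
Frobenius of `L` over `F`. -/
def curveVec (F : Type*) {L : Type*} [Field F] [Fintype F] [Field L] [Algebra F L]
    (x : L) : L × L := (x, frobeniusCurve (FiniteField.frobeniusAlgHom F L : L →+* L) x)

theorem exists_smul_eq_of_mul_frobenius_eq [Finite L] {x y : L} (hx : x ≠ 0)
    (h : x * φ y = y * φ x) : ∃ c : F, c • x = y := by
  have hσ : φ x ≠ 0 := (map_ne_zero _).mpr hx
  obtain ⟨c, hc⟩ := exists_algebraMap_eq_of_frobenius_eq (F := F) (x := y / x) (by
    change φ (y / x) = y / x
    rw [map_div₀]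
    field_simp
    linear_combination h)
  refine ⟨c, ?_⟩
  rw [Algebra.smul_def, hc]
  field_simp

theorem linearIndependent_curveVec {x y z : L} (hx : x ≠ 0) (hy : y ≠ 0) (hz : z ≠ 0)
    (hxy : x * φ y ≠ y * φ x) (hyz : y * φ z ≠ z * φ y) (hzx : z * φ x ≠ x * φ z) :
    LinearIndependent F ![curveVec F x, curveVec F y, curveVec F z] := by
  rw [Fintype.linearIndependent_iff]
  intro c hc
  simp only [Fin.sum_univ_three, curveVec, Matrix.cons_val_zero, Matrix.cons_val_one,
    Matrix.cons_val, Prod.ext_iff, Prod.fst_add, Prod.snd_add, Prod.smul_fst, Prod.smul_snd,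
    Prod.fst_zero, Prod.snd_zero] at hc
  simp only [Algebra.smul_def] at hc
  obtain ⟨h, h'⟩ := hc
  have hσ := fun i => map_algebraMap_frobenius (L := L) (c i)
  have h0 := coeff_eq_zero_of_curve_relation φ hx hxy hzx.symm (hσ 0) (hσ 1) (hσ 2) h h'
  have h1 := coeff_eq_zero_of_curve_relation φ hy hyz hxy.symm (hσ 1) (hσ 2) (hσ 0)
    (by linear_combination h) (by linear_combination h')
  have h2 := coeff_eq_zero_of_curve_relation φ hz hzx hyz.symm (hσ 2) (hσ 0) (hσ 1)
    (by linear_combination h) (by linear_combination h')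
  rw [FaithfulSMul.algebraMap_eq_zero_iff] at h0 h1 h2
  intro i
  fin_cases i <;> assumption

/-- No plane contains five points of the Frobenius curve. -/
theorem not_five_curveVec_mem_plane (W : Submodule F (L × L)) (hW : Module.finrank F W = 3)
    (g : Fin 5 → L) (hg0 : ∀ i, g i ≠ 0) (hgW : ∀ i, curveVec F (g i) ∈ W)
    (hg : ∀ i j, i ≠ j → g i * φ (g j) ≠ g j * φ (g i)) : False := by
  have : FiniteDimensional F W := FiniteDimensional.of_finrank_pos (by omega)
  have hli := linearIndependent_curveVec (F := F) (hg0 0) (hg0 1) (hg0 2)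
    (hg 0 1 (by decide)) (hg 1 2 (by decide)) (hg 2 0 (by decide))
  have hspan : Submodule.span F (Set.range ![curveVec F (g 0), curveVec F (g 1), curveVec F (g 2)])
      = W := by
    apply Submodule.eq_of_le_of_finrank_eq
    · rw [Submodule.span_le]
      rintro _ ⟨i, rfl⟩
      fin_cases i <;> exact hgW _
    · rw [finrank_span_eq_card hli, hW]; simp
  have key : ∀ i, ∃ a b c : F,
      algebraMap F L a * g 0 + algebraMap F L b * g 1 + algebraMap F L c * g 2 = g i ∧
      algebraMap F L a * frobeniusCurve φ (g 0) + algebraMap F L b * frobeniusCurve φ (g 1) +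
        algebraMap F L c * frobeniusCurve φ (g 2) = frobeniusCurve φ (g i) := by
    intro i
    have hi := hgW i
    rw [← hspan, Submodule.mem_span_range_iff_exists_fun] at hi
    obtain ⟨c, hc⟩ := hi
    refine ⟨c 0, c 1, c 2, ?_⟩
    simpa [Fin.sum_univ_three, curveVec, Prod.ext_iff, Algebra.smul_def] using hc
  obtain ⟨a, b, c, h, h'⟩ := key 3
  obtain ⟨d, e, f, k, k'⟩ := key 4
  exact hg 3 4 (by decide) (mul_map_eq_of_mem_curve_plane φ (hg0 0) (hg0 1) (hg0 2) (hg0 3) (hg0 4)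
    (hg 0 1 (by decide)) (hg 1 2 (by decide)) (hg 2 0 (by decide)) (hg 0 3 (by decide))
    (hg 1 3 (by decide)) (hg 2 3 (by decide)) (hg 0 4 (by decide)) (hg 1 4 (by decide))
    (hg 2 4 (by decide)) (map_algebraMap_frobenius a) (map_algebraMap_frobenius b)
    (map_algebraMap_frobenius c) (map_algebraMap_frobenius d) (map_algebraMap_frobenius e)
    (map_algebraMap_frobenius f) h h' k k')

end Points

theorem exists_four_two_set (F : Type) [Field F] [Fintype F] (k : ℕ) :
    ∃ X : Set (Submodule F (Fin (2 * (k + 1) - 1 + 1) → F)),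
      IsRSSet F (2 * (k + 1) - 1) 4 2 X ∧ X.ncard = Fintype.card F ^ k := by
  obtain ⟨L, _, _, _, hL⟩ := exists_finite_extension F k
  have : FiniteDimensional F L := Module.Finite.of_finite
  obtain ⟨e⟩ : Nonempty ((Fin (k + 1) → F) ≃ₗ[F] L) :=
    FiniteDimensional.nonempty_linearEquiv_of_finrank_eq (by simp [hL])
  obtain ⟨E⟩ : Nonempty ((L × L) ≃ₗ[F] (Fin (2 * (k + 1) - 1 + 1) → F)) :=
    FiniteDimensional.nonempty_linearEquiv_of_finrank_eq (by
      rw [Module.finrank_prod, hL, Module.finrank_fin_fun]; omega)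
  let pt : (Fin k → F) → L := fun s => e (Fin.cons 1 s)
  have hpt0 : ∀ s, pt s ≠ 0 := fun s h => by
    have := congrFun ((map_eq_zero_iff e e.injective).mp h) 0
    simp at this
  have hpt : ∀ s t (c : F), c • pt s = pt t → s = t := fun s t c h => by
    rw [← map_smul] at h
    have h := e.injective h
    have h0 : c = 1 := by simpa using congrFun h 0
    subst h0
    rw [one_smul] at h
    exact (Fin.cons_injective2 h).2
  let P : (Fin k → F) → Submodule F (Fin (2 * (k + 1) - 1 + 1) → F) :=
    fun s => Submodule.span F {E (curveVec F (pt s))}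
  have hPinj : Function.Injective P := fun s t h => by
    have hmem : E (curveVec F (pt t)) ∈ P s := by
      rw [h]; exact Submodule.mem_span_singleton_self _
    obtain ⟨c, hc⟩ := Submodule.mem_span_singleton.mp hmem
    rw [← map_smul] at hc
    exact hpt s t c (congrArg Prod.fst (E.injective hc))
  refine ⟨Set.range P, ⟨?_, ?_⟩, ?_⟩
  · rintro _ ⟨s, rfl⟩
    apply finrank_span_singleton
    rw [Ne, map_eq_zero_iff E E.injective]
    exact fun h => hpt0 s (congrArg Prod.fst h)
  · intro W hW
    by_contra! hlt
    have himg : {Q ∈ Set.range P | Q ≤ W} = P '' {s | P s ≤ W} := by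
      ext Q
      constructor
      · rintro ⟨⟨s, rfl⟩, h⟩
        exact ⟨s, h, rfl⟩
      · rintro ⟨s, h, rfl⟩
        exact ⟨⟨s, rfl⟩, h⟩
    rw [himg, Set.ncard_image_of_injective _ hPinj, ← Nat.card_coe_set_eq] at hlt
    let g : Fin 5 → {s | P s ≤ W} := (Finite.equivFin _).symm ∘ Fin.castLE hlt
    have hg : Function.Injective g :=
      (Finite.equivFin _).symm.injective.comp (Fin.castLE_injective hlt)
    refine not_five_curveVec_mem_plane (W.comap (E : (L × L) →ₗ[F] _)) ?_ (fun i => pt (g i)) (fun i => hpt0 _)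
      (fun i => ?_) (fun i j hij h => ?_)
    · rw [Submodule.comap_equiv_eq_map_symm, LinearEquiv.finrank_map_eq, hW]
    · exact (g i).2 (Submodule.mem_span_singleton_self _)
    · obtain ⟨c, hc⟩ := exists_smul_eq_of_mul_frobenius_eq (hpt0 _) h
      exact hij (hg (Subtype.ext (hpt _ _ c hc)))
  · rw [← Nat.card_coe_set_eq, Nat.card_range_of_injective hPinj]
    simp

/-- For `n = 2m - 1` and `q` large enough there is a `(4, 2)`-set of size at least
`(1 - ε) q^((n-1)/2) = (1 - ε) q^(m-1)` in `PG(n, q)`. -/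
theorem exists_large_four_two_set (m : ℕ) (hm : 2 ≤ m) (ε : ℝ) (hε : 0 < ε) :
    ∃ q₀ : ℕ, ∀ (q : ℕ), q₀ ≤ q → ∀ (F : Type) [Field F] [Fintype F],
      Fintype.card F = q →
        ∃ X : Set (Submodule F (Fin (2 * m - 1 + 1) → F)),
          IsRSSet F (2 * m - 1) 4 2 X ∧
          (1 - ε) * (q : ℝ) ^ (m - 1) ≤ (X.ncard : ℝ) := by
  refine ⟨0, fun q _ F _ _ hq => ?_⟩
  obtain ⟨k, rfl⟩ : ∃ k, m = k + 1 := ⟨m - 1, by omega⟩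
  obtain ⟨X, hX, hcard⟩ := exists_four_two_set F k
  refine ⟨X, hX, ?_⟩
  rw [hcard, hq, Nat.add_sub_cancel, Nat.cast_pow]
  exact mul_le_of_le_one_left (by positivity) (by linarith)
end

section
/- For every ε > 0 there exists q₀ such that for every prime power q ≥ q₀ there exists a (9, 2)-set in PG(4, q) of size at least (1 - ε) · q²; that is, a set of at least (1 - ε) q² points of PG(4, q) such that no plane of PG(4, q) contains more than 9 of them. -/
namespace NormQuarticGraph

open Module Polynomial

theorem exists_quadratic_extension (F : Type) [Field F] [Finite F] :
    ∃ (K : Type) (_ : Field K) (_ : Algebra F K) (σ : K →ₐ[F] K),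
      Finite K ∧ finrank F K = 2 ∧ (∀ x, σ (σ x) = x) ∧
      (∀ x, algebraMap F K (Algebra.norm F x) = x * σ x) ∧
      (∀ x, algebraMap F K (Algebra.trace F K x) = x + σ x) := by
  obtain ⟨p, hp⟩ := CharP.exists F
  have : Fact p.Prime := ⟨CharP.char_is_prime F p⟩
  let K := FiniteField.Extension F p 2
  have hK : finrank F K = 2 := FiniteField.finrank_extension F p 2
  refine ⟨K, inferInstance, inferInstance, (FiniteField.Extension.frob F p 2).toAlgHom,
    inferInstance, hK, fun x ↦ ?_, fun x ↦ ?_, fun x ↦ ?_⟩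
  · have := Fintype.ofFinite K
    have hc : Nat.card K = Nat.card F ^ 2 := FiniteField.natCard_extension F p 2
    have h := FiniteField.pow_card x
    rw [← Nat.card_eq_fintype_card, hc] at h
    rw [sq, pow_mul] at h
    exact ((FiniteField.Extension.frob_apply F p 2).trans
      (congrArg (· ^ Nat.card F) (FiniteField.Extension.frob_apply F p 2))).trans h
  · rw [FiniteField.algebraMap_norm_eq_prod_pow, hK]
    simp [Finset.prod_range_succ, K]
  · rw [FiniteField.algebraMap_trace_eq_sum_pow, hK]
    simp [Finset.sum_range_succ, K]

theorem exists_ne_zero_sq_ne_one {F : Type*} [Field F] [Fintype F] (h : 4 ≤ Fintype.card F) :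
    ∃ z : F, z ≠ 0 ∧ z ^ 2 ≠ 1 := by
  classical
  obtain ⟨z, -, hz⟩ := Finset.exists_mem_notMem_of_card_lt_card
    (s := ({0, 1, -1} : Finset F)) (t := Finset.univ)
    (lt_of_le_of_lt Finset.card_le_three (by rw [Finset.card_univ]; omega))
  simp only [Finset.mem_insert, Finset.mem_singleton, not_or] at hz
  exact ⟨z, hz.1, by rw [Ne, sq_eq_one_iff]; tauto⟩

theorem ncard_le_of_forall_eval_eq_zero {K : Type*} [Field K] {P : K[X]} (hP : P ≠ 0) {n : ℕ}
    (hn : P.natDegree ≤ n) {T : Set K} (hT : ∀ x ∈ T, P.eval x = 0) : T.ncard ≤ n := by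
  classical
  have hsub : T ⊆ (P.roots.toFinset : Set K) := fun x hx ↦ by
    simpa [hP] using hT x hx
  calc T.ncard ≤ (P.roots.toFinset : Set K).ncard := Set.ncard_le_ncard hsub
    _ = P.roots.toFinset.card := Set.ncard_coe_finset _
    _ ≤ P.roots.card := Multiset.toFinset_card_le _
    _ ≤ n := (card_roots' P).trans hn

section

variable {F K : Type} [Field F] [Field K] [Algebra F K]

/-- The binary quadratic form `x ↦ x x̄` together with the binary quartic form
`x ↦ x⁴ + x̄⁴ - (z + z⁻¹) (x x̄)²`, where `x̄ = σ x` is the conjugate of `x`. -/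
structure IsNormQuarticPair (σ : K →ₐ[F] K) (z : F) (f g : K → F) : Prop where
  finrank_eq : finrank F K = 2
  involutive : ∀ x, σ (σ x) = x
  quadratic : ∀ x, algebraMap F K (f x) = x * σ x
  quartic : ∀ x, algebraMap F K (g x) =
    x ^ 4 + σ x ^ 4 - algebraMap F K (z + z⁻¹) * (x * σ x) ^ 2

variable {σ : K →ₐ[F] K} {z : F} {f g : K → F}

theorem quartic_ne_zero (hσ : ∀ x, σ (σ x) = x) (hz : z ≠ 0) (hz1 : z ^ 2 ≠ 1) {d : K}
    (hd : d ≠ 0) :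
    d ^ 4 + σ d ^ 4 - algebraMap F K (z + z⁻¹) * (d * σ d) ^ 2 ≠ 0 := by
  have key : ∀ w : F, w ^ 2 ≠ 1 → d ^ 2 - algebraMap F K w * σ d ^ 2 ≠ 0 := by
    intro w hw h
    have h1 : d ^ 2 = algebraMap F K w * σ d ^ 2 := sub_eq_zero.1 h
    have h2 : σ d ^ 2 = algebraMap F K w * d ^ 2 := by
      have := congrArg σ h1
      simpa [hσ] using this
    have h3 : (algebraMap F K w ^ 2 - 1) * d ^ 2 = 0 := by
      linear_combination (-1 : K) * h1 - algebraMap F K w * h2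
    have h4 : algebraMap F K w ^ 2 = 1 :=
      sub_eq_zero.1 ((mul_eq_zero.1 h3).resolve_right (pow_ne_zero 2 hd))
    exact hw ((algebraMap F K).injective (by simpa using h4))
  have hinv : algebraMap F K z * algebraMap F K z⁻¹ = 1 := by
    rw [← map_mul, mul_inv_cancel₀ hz, map_one]
  have hfac : d ^ 4 + σ d ^ 4 - algebraMap F K (z + z⁻¹) * (d * σ d) ^ 2 =
      (d ^ 2 - algebraMap F K z * σ d ^ 2) * (d ^ 2 - algebraMap F K z⁻¹ * σ d ^ 2) := by
    rw [map_add]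
    linear_combination (-(σ d ^ 4)) * hinv
  rw [hfac]
  exact mul_ne_zero (key z hz1) (key z⁻¹ (by simpa [inv_pow] using hz1))

theorem exists_dual_eq [Finite K] (htr : ∀ x, algebraMap F K (Algebra.trace F K x) = x + σ x)
    (l : K →ₗ[F] F) : ∃ α : K, ∀ x, algebraMap F K (l x) = α * x + σ α * σ x := by
  have := Finite.of_injective _ (algebraMap F K).injective
  refine ⟨((Algebra.traceForm F K).toDual (traceForm_nondegenerate F K)).symm l, fun x ↦ ?_⟩
  rw [← map_mul, ← htr, ← Algebra.traceForm_apply, LinearMap.BilinForm.apply_toDual_symm_apply]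

/-- A plane complementary to the last two coordinates meets the graph in the zeros of a monic
polynomial of degree `8`. -/
theorem ncard_le_of_eq_affine [Finite K] (h : IsNormQuarticPair σ z f g)
    (htr : ∀ x, algebraMap F K (Algebra.trace F K x) = x + σ x) (l m : K →ₗ[F] F) (c e : F)
    {T : Set K} (hf : ∀ x ∈ T, f x = c + l x) (hg : ∀ x ∈ T, g x = e + m x) :
    T.ncard ≤ 8 := by
  obtain ⟨α, hα⟩ := exists_dual_eq htr l
  obtain ⟨β, hβ⟩ := exists_dual_eq htr m
  let c' := algebraMap F K c
  let e' := algebraMap F K e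
  let t := algebraMap F K (z + z⁻¹)
  let L : K[X] := X - C (σ α)
  let M : K[X] := C α * X + C c'
  let R : K[X] := M ^ 4 - C t * (X ^ 2 * L ^ 2 * M ^ 2) - (C β * X + C e') * L ^ 4
    - C (σ β) * M * L ^ 3
  have hlead : (X ^ 4 * L ^ 4).Monic := (monic_X_pow 4).mul ((monic_X_sub_C _).pow 4)
  have hdeg : (X ^ 4 * L ^ 4).natDegree = 8 := by
    rw [(monic_X_pow 4).natDegree_mul ((monic_X_sub_C _).pow 4), natDegree_X_pow,
      (monic_X_sub_C _).natDegree_pow, natDegree_X_sub_C]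
  have hR : R.natDegree ≤ 6 := by
    simp only [R, L, M]
    compute_degree
  have hlt : R.degree < (X ^ 4 * L ^ 4).degree :=
    degree_lt_degree (by omega)
  refine ncard_le_of_forall_eval_eq_zero (P := X ^ 4 * L ^ 4 + R)
    (hlead.add_of_left hlt).ne_zero
    ((natDegree_add_le _ _).trans (by omega)) fun x hx ↦ ?_
  have h1 : x * σ x = c' + (α * x + σ α * σ x) := by
    rw [← h.quadratic, hf x hx, map_add, hα]
  have h2 : x ^ 4 + σ x ^ 4 - t * (x * σ x) ^ 2 = e' + (β * x + σ β * σ x) := by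
    rw [← h.quartic, hg x hx, map_add, hβ]
  have h3 : α * x + c' = (x - σ α) * σ x := by linear_combination -h1
  simp only [R, L, M, eval_add, eval_sub, eval_mul, eval_pow, eval_X, eval_C, h3]
  linear_combination (x - σ α) ^ 4 * h2

/-- On an affine line, a nontrivial combination of the quartic and the quadratic form has
degree `4` or `2`. -/
theorem ncard_le_of_line (h : IsNormQuarticPair σ z f g) (hz : z ≠ 0) (hz1 : z ^ 2 ≠ 1)
    {x₀ d : K} (hd : d ≠ 0) {b c : F} (hbc : b ≠ 0 ∨ c ≠ 0) (k k' : F) {T : Set K}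
    (hT : ∀ x ∈ T, ∃ s : F, x = x₀ + s • d ∧ b * g x - c * f x = k + s * k') :
    T.ncard ≤ 4 := by
  let b' := algebraMap F K b
  let c' := algebraMap F K c
  let t := algebraMap F K (z + z⁻¹)
  let L : K[X] := C d * X + C x₀
  let M : K[X] := C (σ d) * X + C (σ x₀)
  let P : K[X] := C b' * (L ^ 4 + M ^ 4 - C t * (L * M) ^ 2) - C c' * (L * M)
    - C (algebraMap F K k') * X - C (algebraMap F K k)
  have hdeg : P.natDegree ≤ 4 := by
    simp only [P, L, M]
    compute_degree
  have hP : P ≠ 0 := by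
    intro hP
    have h4 : P.coeff 4 = b' * (d ^ 4 + σ d ^ 4 - t * (d * σ d) ^ 2) := by
      simp only [P, L, M]
      compute_degree!
    have hb : b' = 0 := by
      rw [hP, coeff_zero] at h4
      exact (mul_eq_zero.1 h4.symm).resolve_right (quartic_ne_zero h.involutive hz hz1 hd)
    have hLM : (L * M).coeff 2 = d * σ d := by
      simp only [L, M]
      compute_degree!
    have h2 : P.coeff 2 = -(c' * (d * σ d)) := by
      simp [P, hb, hLM]
    have hc : c' = 0 := by
      rw [hP, coeff_zero] at h2
      refine (mul_eq_zero.1 (neg_eq_zero.1 h2.symm)).resolve_right (mul_ne_zero hd ?_)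
      exact (map_ne_zero σ).2 hd
    rcases hbc with hbc | hbc
    · exact hbc ((map_eq_zero _).1 hb)
    · exact hbc ((map_eq_zero _).1 hc)
  have hsub : ∀ x ∈ T, ∃ y, P.eval y = 0 ∧ x = x₀ + y * d := by
    intro x hx
    obtain ⟨s, hs, he⟩ := hT x hx
    refine ⟨algebraMap F K s, ?_, by rw [hs, Algebra.smul_def]⟩
    have hσx : σ x = σ d * algebraMap F K s + σ x₀ := by
      rw [hs, map_add, map_smul, Algebra.smul_def]; ring
    have hx' : x = d * algebraMap F K s + x₀ := by rw [hs, Algebra.smul_def]; ring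
    have he' := congrArg (algebraMap F K) he
    rw [map_sub, map_mul, map_mul, h.quadratic, h.quartic, map_add (algebraMap F K) k, map_mul] at he'
    simp only [P, L, M, eval_add, eval_sub, eval_mul, eval_pow, eval_X, eval_C, ← hσx, ← hx']
    linear_combination he'
  have hinj : Function.Injective fun x : K ↦ (x - x₀) / d := fun x y hxy ↦ by
    simpa [div_left_inj' hd] using hxy
  rw [← Set.ncard_image_of_injective T hinj]
  refine ncard_le_of_forall_eval_eq_zero hP hdeg ?_
  rintro _ ⟨x, hx, rfl⟩
  obtain ⟨y, hy, rfl⟩ := hsub x hx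
  simpa [hd] using hy

/-- The homogeneous coordinates of the point of the graph of `(f, g)` above `x`. -/
def graphVec (f g : K → F) (x : K) : F × K × F × F := (1, x, f x, g x)

theorem ncard_graphVec_mem_le [Finite K] (h : IsNormQuarticPair σ z f g) (hz : z ≠ 0)
    (hz1 : z ^ 2 ≠ 1) (htr : ∀ x, algebraMap F K (Algebra.trace F K x) = x + σ x)
    (W : Submodule F (F × K × F × F)) (hW : finrank F W = 3) :
    {x | graphVec f g x ∈ W}.ncard ≤ 8 := by
  have : FiniteDimensional F K := Module.finite_of_finrank_pos (by rw [h.finrank_eq]; norm_num)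
  let π : W →ₗ[F] F × K :=
    ((LinearMap.fst F F (K × F × F)).prod
      (LinearMap.fst F K (F × F) ∘ₗ LinearMap.snd F F (K × F × F))) ∘ₗ W.subtype
  have hπ : ∀ w : W, π w = (w.1.1, w.1.2.1) := fun w ↦ rfl
  by_cases hinj : Function.Injective π
  · let E : W ≃ₗ[F] F × K := LinearEquiv.ofInjectiveOfFinrankEq π hinj (by
      rw [hW, finrank_prod, finrank_self, h.finrank_eq])
    have hE : ∀ w, E w = π w := fun w ↦ rfl
    let ρ : F × K →ₗ[F] F × F :=
      (LinearMap.snd F K (F × F) ∘ₗ LinearMap.snd F F (K × F × F)) ∘ₗ W.subtype ∘ₗ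
        E.symm.toLinearMap
    have hρ : ∀ x ∈ {x | graphVec f g x ∈ W}, (f x, g x) = ρ (1, 0) + ρ (0, x) := by
      intro x hx
      have h1 : E.symm (1, x) = ⟨graphVec f g x, hx⟩ := by
        rw [LinearEquiv.symm_apply_eq, hE, hπ]; rfl
      rw [← map_add, Prod.mk_add_mk, add_zero, zero_add]
      simp [ρ, h1, graphVec]
    refine ncard_le_of_eq_affine h htr
      (LinearMap.fst F F F ∘ₗ ρ ∘ₗ LinearMap.inr F F K)
      (LinearMap.snd F F F ∘ₗ ρ ∘ₗ LinearMap.inr F F K) (ρ (1, 0)).1 (ρ (1, 0)).2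
      (fun x hx ↦ ?_) (fun x hx ↦ ?_)
    · simpa using congrArg Prod.fst (hρ x hx)
    · simpa using congrArg Prod.snd (hρ x hx)
  · obtain ⟨b, c, hu, hbc⟩ : ∃ b c : F, ((0, 0, b, c) : F × K × F × F) ∈ W ∧
        (b ≠ 0 ∨ c ≠ 0) := by
      rw [← LinearMap.ker_eq_bot, Submodule.eq_bot_iff] at hinj
      push Not at hinj
      obtain ⟨⟨⟨a, y, b, c⟩, hw⟩, hker, hne⟩ := hinj
      obtain ⟨rfl, rfl⟩ : a = 0 ∧ y = 0 := by simpa [hπ] using hker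
      refine ⟨b, c, hw, ?_⟩
      by_contra! hcon
      obtain ⟨rfl, rfl⟩ := hcon
      exact hne rfl
    by_cases hsub : {x | graphVec f g x ∈ W}.Subsingleton
    · exact (Set.ncard_le_one_iff_subsingleton.2 hsub).trans (by norm_num)
    obtain ⟨x₀, hx₀, x₁, hx₁, hne⟩ := Set.not_subsingleton_iff.1 hsub
    have hd : x₁ - x₀ ≠ 0 := sub_ne_zero.2 hne.symm
    let v : Fin 3 → F × K × F × F :=
      ![(0, 0, b, c), graphVec f g x₀, graphVec f g x₁ - graphVec f g x₀]
    have hv : LinearIndependent F v := by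
      rw [Fintype.linearIndependent_iff]
      intro a ha
      simp only [v, graphVec, Fin.sum_univ_three, Matrix.cons_val, Prod.smul_mk, Prod.mk_add_mk,
        Prod.mk_sub_mk, Prod.mk_eq_zero, smul_eq_mul, sub_self, mul_zero, mul_one, add_zero,
        zero_add, smul_zero] at ha
      obtain ⟨h1, h2, h3, h4⟩ := ha
      rw [h1, zero_smul, zero_add] at h2
      have h2' : a 2 = 0 := (smul_eq_zero.1 h2).resolve_right hd
      have h0 : a 0 = 0 := by
        simp only [h1, h2', zero_mul, add_zero, mul_eq_zero] at h3 h4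
        tauto
      intro i
      fin_cases i <;> assumption
    have hspan : Submodule.span F (Set.range v) = W := by
      refine Submodule.eq_of_le_of_finrank_eq (Submodule.span_le.2 ?_) ?_
      · rintro _ ⟨i, rfl⟩
        fin_cases i
        · exact hu
        · exact hx₀
        · exact W.sub_mem hx₁ hx₀
      · rw [finrank_span_eq_card hv, hW, Fintype.card_fin]
    refine (ncard_le_of_line (x₀ := x₀) h hz hz1 hd hbc (b * g x₀ - c * f x₀)
      (b * (g x₁ - g x₀) - c * (f x₁ - f x₀)) fun x hx ↦ ?_).trans (by norm_num : 4 ≤ 8)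
    rw [Set.mem_ofPred_eq, ← hspan, Submodule.mem_span_range_iff_exists_fun] at hx
    obtain ⟨a, ha⟩ := hx
    simp only [v, graphVec, Fin.sum_univ_three, Matrix.cons_val, Prod.smul_mk, Prod.mk_add_mk,
        Prod.mk_sub_mk, Prod.mk.injEq, smul_eq_mul, sub_self, mul_zero, mul_one, add_zero,
        zero_add, smul_zero] at ha
    obtain ⟨h1, h2, h3, h4⟩ := ha
    rw [h1] at h2 h3 h4
    refine ⟨a 2, by rw [← h2, one_smul], ?_⟩
    rw [← h3, ← h4]
    ring

end

theorem isRSSet_range_span {F V A : Type} [Field F] [AddCommGroup V] [Module F V] {n r s : ℕ}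
    (e : V ≃ₗ[F] (Fin (n + 1) → F)) (v : A → V) (hv : ∀ x, v x ≠ 0) [Finite A]
    (h : ∀ W : Submodule F V, finrank F W = s + 1 → {x | v x ∈ W}.ncard ≤ r) :
    IsRSSet F n r s (Set.range fun x ↦ Submodule.span F {e (v x)}) := by
  refine ⟨?_, fun W hW ↦ ?_⟩
  · rintro _ ⟨x, rfl⟩
    exact finrank_span_singleton (e.map_ne_zero_iff.2 (hv x))
  · have hfin : finrank F (W.comap e.toLinearMap) = s + 1 := by
      rw [← hW, Submodule.comap_equiv_eq_map_symm, LinearEquiv.finrank_map_eq]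
    refine le_trans ?_ (h _ hfin)
    refine (Set.ncard_le_ncard ?_).trans
      (Set.ncard_image_le (f := fun x ↦ Submodule.span F {e (v x)}))
    rintro _ ⟨⟨x, rfl⟩, hx⟩
    exact ⟨x, by simpa using hx, rfl⟩

theorem injective_span_graphVec {F K V : Type} [Field F] [Field K] [Algebra F K]
    [AddCommGroup V] [Module F V] (f g : K → F) (e : (F × K × F × F) ≃ₗ[F] V) :
    Function.Injective fun x ↦ Submodule.span F {e (graphVec f g x)} := by
  intro x y hxy
  have hmem : e (graphVec f g x) ∈ Submodule.span F {e (graphVec f g y)} :=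
    hxy.le (Submodule.mem_span_singleton_self _)
  obtain ⟨a, ha⟩ := Submodule.mem_span_singleton.1 hmem
  rw [← map_smul, e.injective.eq_iff] at ha
  simp only [graphVec, Prod.smul_mk, Prod.mk.injEq, smul_eq_mul, mul_one] at ha
  obtain ⟨rfl, h, -⟩ := ha
  simpa using h.symm

end NormQuarticGraph

/-- For `q` large enough there is a `(9, 2)`-set of size at least `(1 - ε) q²`
in `PG(4, q)`. -/
theorem exists_large_nine_two_set (ε : ℝ) (hε : 0 < ε) :
    ∃ q₀ : ℕ, ∀ (q : ℕ), q₀ ≤ q → ∀ (F : Type) [Field F] [Fintype F],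
      Fintype.card F = q →
        ∃ X : Set (Submodule F (Fin (4 + 1) → F)),
          IsRSSet F 4 9 2 X ∧ (1 - ε) * (q : ℝ) ^ 2 ≤ (X.ncard : ℝ) := by
  refine ⟨4, fun q hq F _ _ hF ↦ ?_⟩
  obtain ⟨K, _, _, σ, _, hK, hσ, hnorm, htr⟩ := NormQuarticGraph.exists_quadratic_extension F
  obtain ⟨z, hz, hz1⟩ := NormQuarticGraph.exists_ne_zero_sq_ne_one (hF ▸ hq)
  have : FiniteDimensional F K := Module.finite_of_finrank_pos (by rw [hK]; norm_num)
  let f : K → F := fun x ↦ Algebra.norm F x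
  let g : K → F := fun x ↦ Algebra.trace F K (x ^ 4) - (z + z⁻¹) * Algebra.norm F x ^ 2
  have h : NormQuarticGraph.IsNormQuarticPair σ z f g :=
    ⟨hK, hσ, hnorm, fun x ↦ by simp only [g, map_sub, map_mul, map_pow, hnorm, htr]⟩
  let e : (F × K × F × F) ≃ₗ[F] (Fin (4 + 1) → F) := LinearEquiv.ofFinrankEq _ _ (by simp [hK])
  refine ⟨_, NormQuarticGraph.isRSSet_range_span e (NormQuarticGraph.graphVec f g)
    (fun x hx ↦ one_ne_zero (congrArg Prod.fst hx)) fun W hW ↦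
      (NormQuarticGraph.ncard_graphVec_mem_le h hz hz1 htr W hW).trans (by norm_num), ?_⟩
  have hcard : Nat.card K = q ^ 2 := by
    rw [Module.natCard_eq_pow_finrank (K := F), hK, Nat.card_eq_fintype_card, hF]
  rw [← Set.image_univ, Set.ncard_image_of_injective _
    (NormQuarticGraph.injective_span_graphVec f g e), Set.ncard_univ, hcard, Nat.cast_pow]
  exact mul_le_of_le_one_left (sq_nonneg _) (by linarith)
end

section
/- Let m ≥ 1 be an integer and n = 4^m - 1. For every ε > 0 there exists q₀ such that for every prime power q ≥ q₀ there exists a cap (a (2, 1)-set) in PG(n, q) of size at least (1 - ε) · q^(2n/3); that is, a set of at least (1 - ε) q^(2n/3) points of PG(n, q) with no 3 of them collinear. -/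
/-- Over a finite field there is a binary quadratic form `x² - xy - dy²` without nontrivial zeros. -/
theorem exists_anisotropic_binary_form (F : Type*) [Field F] [Finite F] :
    ∃ d : F, ∀ x y : F, x ^ 2 - x * y - d * y ^ 2 = 0 → x = 0 ∧ y = 0 := by
  have hns : ¬ Function.Surjective (fun x : F => x ^ 2 - x) := fun hs =>
    zero_ne_one ((Finite.injective_iff_surjective.mpr hs) (by simp : (0 : F) ^ 2 - 0 = 1 ^ 2 - 1))
  simp only [Function.Surjective, not_forall, not_exists] at hns
  obtain ⟨d, hd⟩ := hns
  refine ⟨d, fun x y h => ?_⟩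
  by_cases hy : y = 0
  · subst hy
    simpa using h
  · refine absurd ?_ (hd (x / y))
    field_simp
    linear_combination h

/-- The homogeneous coordinates of the point of a product of `k` affine elliptic paraboloids
`z = x² - xy - dy²` lying above the parameters `f`. -/
def paraboloidVec {F : Type*} [Field F] (d : F) {k : ℕ} (f : Fin k → F × F) :
    Option (Fin k × Fin 3) → F
  | none => 1
  | some (j, i) =>
    ![(f j).1, (f j).2, (f j).1 ^ 2 - (f j).1 * (f j).2 - d * (f j).2 ^ 2] i

/-- In a linear relation between three points of a product of anisotropic paraboloids, the
coefficients of two distinct points have product zero. -/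
theorem mul_eq_zero_of_paraboloidVec_relation {F : Type*} [Field F] {d : F}
    (hd : ∀ x y : F, x ^ 2 - x * y - d * y ^ 2 = 0 → x = 0 ∧ y = 0) {k : ℕ}
    {f g h : Fin k → F × F} (hfg : f ≠ g) {a b c : F}
    (hrel : ∀ i, a * paraboloidVec d f i + b * paraboloidVec d g i
      + c * paraboloidVec d h i = 0) : a * b = 0 := by
  by_contra hab
  refine hfg (funext fun j => ?_)
  have h0 : a + b + c = 0 := by simpa [paraboloidVec] using hrel none
  have h1 : a * (f j).1 + b * (g j).1 + c * (h j).1 = 0 := by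
    simpa [paraboloidVec] using hrel (some (j, 0))
  have h2 : a * (f j).2 + b * (g j).2 + c * (h j).2 = 0 := by
    simpa [paraboloidVec] using hrel (some (j, 1))
  have h3 : a * ((f j).1 ^ 2 - (f j).1 * (f j).2 - d * (f j).2 ^ 2)
      + b * ((g j).1 ^ 2 - (g j).1 * (g j).2 - d * (g j).2 ^ 2)
      + c * ((h j).1 ^ 2 - (h j).1 * (h j).2 - d * (h j).2 ^ 2) = 0 := by
    simpa [paraboloidVec] using hrel (some (j, 2))
  have key : a * b * (((f j).1 - (g j).1) ^ 2 - ((f j).1 - (g j).1) * ((f j).2 - (g j).2)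
      - d * ((f j).2 - (g j).2) ^ 2) = 0 := by
    generalize (f j).1 = x₁ at *
    generalize (f j).2 = y₁ at *
    generalize (g j).1 = x₂ at *
    generalize (g j).2 = y₂ at *
    generalize (h j).1 = x₃ at *
    generalize (h j).2 = y₃ at *
    obtain rfl : c = -(a + b) := by linear_combination h0
    linear_combination (a + b) * h3 - (a * x₁ + b * x₂ + (a + b) * x₃) * h1
      + (a * x₁ + b * x₂) * h2 + (a + b) * y₃ * h1
      + d * (a * y₁ + b * y₂ + (a + b) * y₃) * h2
  obtain ⟨hx, hy⟩ := hd _ _ ((mul_eq_zero.mp key).resolve_left hab)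
  exact Prod.ext (sub_eq_zero.mp hx) (sub_eq_zero.mp hy)

theorem linearIndependent_paraboloidVec {F : Type*} [Field F] {d : F}
    (hd : ∀ x y : F, x ^ 2 - x * y - d * y ^ 2 = 0 → x = 0 ∧ y = 0) {k : ℕ}
    {f g h : Fin k → F × F} (hfg : f ≠ g) (hfh : f ≠ h) (hgh : g ≠ h) :
    LinearIndependent F ![paraboloidVec d f, paraboloidVec d g, paraboloidVec d h] := by
  rw [Fintype.linearIndependent_iff]
  intro a ha
  have hrel : ∀ i, a 0 * paraboloidVec d f i + a 1 * paraboloidVec d g i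
      + a 2 * paraboloidVec d h i = 0 := fun i => by
    simpa [Fin.sum_univ_three] using congrFun ha i
  have h0 : a 0 + a 1 + a 2 = 0 := by simpa [paraboloidVec] using hrel none
  have h01 : a 0 * a 1 = 0 := mul_eq_zero_of_paraboloidVec_relation hd hfg hrel
  have h02 : a 0 * a 2 = 0 := mul_eq_zero_of_paraboloidVec_relation hd hfh (h := g) (c := a 1)
    fun i => by linear_combination hrel i
  have h12 : a 1 * a 2 = 0 := mul_eq_zero_of_paraboloidVec_relation hd hgh (h := f) (c := a 0)
    fun i => by linear_combination hrel i
  intro i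
  refine pow_eq_zero_iff (two_ne_zero) |>.mp ?_
  fin_cases i
  · change a 0 ^ 2 = 0
    linear_combination a 0 * h0 - h01 - h02
  · change a 1 ^ 2 = 0
    linear_combination a 1 * h0 - h01 - h12
  · change a 2 ^ 2 = 0
    linear_combination a 2 * h0 - h02 - h12

theorem injective_span_paraboloidVec {F : Type*} [Field F] (d : F) (k : ℕ) :
    Function.Injective fun f : Fin k → F × F => Submodule.span F {paraboloidVec d f} := by
  intro f g hfg
  have hmem : paraboloidVec d f ∈ Submodule.span F {paraboloidVec d g} := by
    rw [← show Submodule.span F {paraboloidVec d f} = Submodule.span F {paraboloidVec d g} from hfg]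
    exact Submodule.mem_span_singleton_self _
  obtain ⟨c, hc⟩ := Submodule.mem_span_singleton.mp hmem
  obtain rfl : c = 1 := by simpa [paraboloidVec] using congrFun hc none
  rw [one_smul] at hc
  funext j
  refine Prod.ext ?_ ?_
  · simpa [paraboloidVec] using (congrFun hc (some (j, 0))).symm
  · simpa [paraboloidVec] using (congrFun hc (some (j, 1))).symm

/-- `PG(3k, q)` contains a cap of size `q^(2k)`. -/
theorem exists_cap_ncard_eq (F : Type) [Field F] [Fintype F] {n k : ℕ} (hn : n = 3 * k) :
    ∃ X : Set (Submodule F (Fin (n + 1) → F)),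
      IsRSSet F n 2 1 X ∧ X.ncard = Fintype.card F ^ (2 * k) := by
  obtain ⟨d, hd⟩ := exists_anisotropic_binary_form F
  let e : Fin (n + 1) ≃ Option (Fin k × Fin 3) :=
    Fintype.equivOfCardEq (by simp [hn, mul_comm])
  let L : (Option (Fin k × Fin 3) → F) ≃ₗ[F] (Fin (n + 1) → F) := LinearEquiv.funCongrLeft F F e
  let p : (Fin k → F × F) → Submodule F (Fin (n + 1) → F) :=
    fun f => Submodule.span F {L (paraboloidVec d f)}
  have hp : ∀ f, p f = (Submodule.span F {paraboloidVec d f}).map L.toLinearMap := fun f => by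
    simp [p, Submodule.map_span]
  have hinj : Function.Injective p := fun f g hfg => by
    rw [hp, hp] at hfg
    exact injective_span_paraboloidVec d k (Submodule.map_injective_of_injective L.injective hfg)
  refine ⟨Set.range p, ⟨?_, fun W hW => ?_⟩, ?_⟩
  · rintro _ ⟨f, rfl⟩
    refine finrank_span_singleton fun h0 => ?_
    simpa [paraboloidVec] using congrFun (L.map_eq_zero_iff.mp h0) none
  · by_contra! hlt
    obtain ⟨_, ⟨⟨f, rfl⟩, hf⟩, _, ⟨⟨g, rfl⟩, hg⟩, _, ⟨⟨h, rfl⟩, hh⟩, hfg, hfh, hgh⟩ :=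
      (Set.two_lt_ncard (Set.toFinite _)).mp hlt
    have hli := (linearIndependent_paraboloidVec hd (ne_of_apply_ne p hfg)
      (ne_of_apply_ne p hfh) (ne_of_apply_ne p hgh)).map' L.toLinearMap L.ker
    have hle : Submodule.span F (Set.range (L.toLinearMap ∘
        ![paraboloidVec d f, paraboloidVec d g, paraboloidVec d h])) ≤ W := by
      rw [Submodule.span_le]
      rintro _ ⟨i, rfl⟩
      fin_cases i
      · exact hf (Submodule.mem_span_singleton_self _)
      · exact hg (Submodule.mem_span_singleton_self _)
      · exact hh (Submodule.mem_span_singleton_self _)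
    have := Submodule.finrank_mono hle
    rw [finrank_span_eq_card hli, hW, Fintype.card_fin] at this
    omega
  · rw [← Nat.card_coe_set_eq, Nat.card_range_of_injective hinj]
    simp [pow_mul, sq]

/-- For `n = 4^m - 1` and `q` large enough there is a cap of size at least
`(1 - ε) q^(2n/3)` in `PG(n, q)`; here `2n/3 = 2(4^m - 1)/3` is an integer. -/
theorem exists_large_cap (m : ℕ) (hm : 1 ≤ m) (ε : ℝ) (hε : 0 < ε) :
    ∃ q₀ : ℕ, ∀ (q : ℕ), q₀ ≤ q → ∀ (F : Type) [Field F] [Fintype F],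
      Fintype.card F = q →
        ∃ X : Set (Submodule F (Fin (4 ^ m - 1 + 1) → F)),
          IsRSSet F (4 ^ m - 1) 2 1 X ∧
          (1 - ε) * (q : ℝ) ^ (2 * (4 ^ m - 1) / 3) ≤ (X.ncard : ℝ) := by
  refine ⟨0, fun q _ F _ _ hq => ?_⟩
  obtain ⟨k, hk⟩ : 3 ∣ 4 ^ m - 1 := by simpa using Nat.sub_dvd_pow_sub_pow 4 1 m
  obtain ⟨X, hX, hcard⟩ := exists_cap_ncard_eq F hk
  refine ⟨X, hX, ?_⟩
  have hexp : 2 * (4 ^ m - 1) / 3 = 2 * k := by omega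
  rw [hcard, hq, hexp, Nat.cast_pow]
  exact mul_le_of_le_one_left (by positivity) (by linarith)
end

section
/- For every ε > 0 there exists q₀ such that for every prime power q ≥ q₀, the number of irreducible homogeneous polynomials of degree 3 in F_q[X, Y, Z], counted up to multiplication by nonzero scalars (equivalently, the total number of irreducible homogeneous cubic polynomials divided by q - 1), is at least (1 - ε) · q^9. -/
open MvPolynomial in
/-- The homogeneous component of a product in the degree that is the sum of the total degrees of
the factors is the product of the leading homogeneous components of the factors. -/
theorem homogeneousComponent_totalDegree_add_mul {σ R : Type*} [CommSemiring R]
    (a b : MvPolynomial σ R) :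
    homogeneousComponent (a.totalDegree + b.totalDegree) (a * b) =
      homogeneousComponent a.totalDegree a * homogeneousComponent b.totalDegree b := by
  classical
  ext d
  by_cases hd : d.degree = a.totalDegree + b.totalDegree
  · rw [coeff_homogeneousComponent, if_pos hd, coeff_mul, coeff_mul]
    refine Finset.sum_congr rfl fun ⟨u, v⟩ huv => ?_
    have huv' : u.degree + v.degree = a.totalDegree + b.totalDegree := by
      rw [← hd, ← Finset.HasAntidiagonal.mem_antidiagonal.mp huv, map_add]
    dsimp only
    rw [coeff_homogeneousComponent, coeff_homogeneousComponent]
    rcases lt_trichotomy u.degree a.totalDegree with h | h | h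
    · have hv : b.totalDegree < v.degree := by omega
      rw [coeff_eq_zero_of_totalDegree_lt (f := b) hv]
      simp
    · rw [if_pos h, if_pos (by omega)]
    · rw [coeff_eq_zero_of_totalDegree_lt (f := a) h]
      simp
  · rw [coeff_homogeneousComponent, if_neg hd]
    exact (((homogeneousComponent_isHomogeneous _ a).mul
      (homogeneousComponent_isHomogeneous _ b)).coeff_eq_zero hd).symm

open MvPolynomial in
/-- A homogeneous cubic over a field that is not irreducible is the product of a linear form and
a quadratic form. -/
theorem exists_linear_mul_quadratic_of_not_irreducible {σ F : Type*} [Field F]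
    {p : MvPolynomial σ F} (hp : p.IsHomogeneous 3) (hirr : ¬ Irreducible p) :
    ∃ a b : MvPolynomial σ F, a.IsHomogeneous 1 ∧ b.IsHomogeneous 2 ∧ a * b = p := by
  rcases eq_or_ne p 0 with rfl | h0
  · exact ⟨0, 0, isHomogeneous_zero _ _ _, isHomogeneous_zero _ _ _, zero_mul _⟩
  have hdeg := hp.totalDegree h0
  have hunit : ∀ a : MvPolynomial σ F, a ≠ 0 → a.totalDegree = 0 → IsUnit a := by
    intro a ha hd
    rw [totalDegree_eq_zero_iff_eq_C] at hd
    rw [hd]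
    exact (isUnit_iff_ne_zero.mpr fun h => ha (by rw [hd, h, C_0])).map C
  have hpu : ¬ IsUnit p := by
    rw [isUnit_iff_totalDegree_of_isReduced]
    omega
  obtain ⟨a, b, hab, ha, hb⟩ : ∃ a b, p = a * b ∧ ¬ IsUnit a ∧ ¬ IsUnit b := by
    by_contra! h
    exact hirr ⟨hpu, fun a b hab => or_iff_not_imp_left.mpr (h a b hab)⟩
  have ha0 : a ≠ 0 := by rintro rfl; simp [hab] at h0
  have hb0 : b ≠ 0 := by rintro rfl; simp [hab] at h0
  have hsum : a.totalDegree + b.totalDegree = 3 := by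
    rw [← totalDegree_mul_of_isDomain ha0 hb0, ← hab, hdeg]
  have hprod := homogeneousComponent_totalDegree_add_mul a b
  rw [hsum, ← hab, homogeneousComponent_of_mem hp, if_pos rfl] at hprod
  have ha1 := mt (hunit a ha0) ha
  have hb1 := mt (hunit b hb0) hb
  have hacomp := homogeneousComponent_isHomogeneous a.totalDegree a
  have hbcomp := homogeneousComponent_isHomogeneous b.totalDegree b
  obtain h | h : (a.totalDegree = 1 ∧ b.totalDegree = 2) ∨
      (a.totalDegree = 2 ∧ b.totalDegree = 1) := by omega
  · rw [h.1, h.2] at hprod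
    rw [h.1] at hacomp
    rw [h.2] at hbcomp
    exact ⟨_, _, hacomp, hbcomp, hprod.symm⟩
  · rw [h.1, h.2, mul_comm] at hprod
    rw [h.1] at hacomp
    rw [h.2] at hbcomp
    exact ⟨_, _, hbcomp, hacomp, hprod.symm⟩

open MvPolynomial in
/-- The number of homogeneous polynomials of degree `n` in finitely many variables over a finite
ring `R` is the cardinality of `R` to the number of monomials of degree `n`. -/
theorem card_homogeneousSubmodule (σ R : Type*) [Fintype σ] [CommSemiring R]
    [Fintype R] (n : ℕ) :
    Nat.card (homogeneousSubmodule σ R n) =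
      Fintype.card R ^ (Fintype.card σ + n - 1).choose n := by
  classical
  have hset : {d : σ →₀ ℕ | d.degree = n} = (Finset.univ.finsuppAntidiag n : Finset (σ →₀ ℕ)) := by
    ext d
    simp [Finsupp.degree_eq_sum]
  have hsub : homogeneousSubmodule σ R n =
      restrictSupport R (Finset.univ.finsuppAntidiag n : Finset (σ →₀ ℕ)) := by
    rw [homogeneousSubmodule_eq_finsupp_supported, hset]
    rfl
  rw [hsub, Nat.card_congr (basisRestrictSupport R _).equivFun.toEquiv]
  rw [Nat.card_fun, Nat.card_coe_set_eq, Set.ncard_coe_finset,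
    Finset.card_finsuppAntidiag_nat_eq_choose, Nat.card_eq_fintype_card, Finset.card_univ]

open MvPolynomial in
/-- There are at least `q ^ 10 - q ^ 9` irreducible ternary cubic forms over a field with `q`
elements. -/
theorem card_pow_ten_le_ncard_irreducible_cubics (F : Type*) [Field F] [Fintype F] :
    Fintype.card F ^ 10 ≤ {p : MvPolynomial (Fin 3) F | p.IsHomogeneous 3 ∧ Irreducible p}.ncard +
      Fintype.card F ^ 9 := by
  have hcard : ∀ n, (homogeneousSubmodule (Fin 3) F n : Set (MvPolynomial (Fin 3) F)).ncard =
      Fintype.card F ^ (3 + n - 1).choose n := fun n => by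
    simpa using! card_homogeneousSubmodule (Fin 3) F n
  have hfin : ∀ n, (homogeneousSubmodule (Fin 3) F n : Set (MvPolynomial (Fin 3) F)).Finite :=
    fun n => Set.finite_of_ncard_pos (by rw [hcard]; exact pow_pos Fintype.card_pos _)
  set I := {p : MvPolynomial (Fin 3) F | p.IsHomogeneous 3 ∧ Irreducible p}
  set P := (homogeneousSubmodule (Fin 3) F 1 : Set (MvPolynomial (Fin 3) F)) ×ˢ
    (homogeneousSubmodule (Fin 3) F 2 : Set (MvPolynomial (Fin 3) F))
  have hP : P.Finite := (hfin 1).prod (hfin 2)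
  have hsub : (homogeneousSubmodule (Fin 3) F 3 : Set (MvPolynomial (Fin 3) F)) ⊆
      I ∪ (fun x => x.1 * x.2) '' P := by
    intro p hp
    by_cases hirr : Irreducible p
    · exact Or.inl ⟨hp, hirr⟩
    · obtain ⟨a, b, ha, hb, hab⟩ := exists_linear_mul_quadratic_of_not_irreducible hp hirr
      exact Or.inr ⟨(a, b), ⟨ha, hb⟩, hab⟩
  have hI : I.Finite := (hfin 3).subset fun p hp => hp.1
  have hPcard : P.ncard = Fintype.card F ^ 9 := by
    rw [Set.ncard_prod, hcard, hcard, ← pow_add]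
    rfl
  calc Fintype.card F ^ 10
      = (homogeneousSubmodule (Fin 3) F 3 : Set (MvPolynomial (Fin 3) F)).ncard := (hcard 3).symm
    _ ≤ (I ∪ (fun x => x.1 * x.2) '' P).ncard :=
        Set.ncard_le_ncard hsub (hI.union (hP.image _))
    _ ≤ I.ncard + ((fun x => x.1 * x.2) '' P).ncard := Set.ncard_union_le _ _
    _ ≤ I.ncard + Fintype.card F ^ 9 := by
        grw [Set.ncard_image_le hP, hPcard]


/-- For `q` large enough, the number of irreducible homogeneous cubic polynomials in
`F_q[X, Y, Z]` is at least `(1 - ε) (q - 1) q^9` (equivalently, counted up to nonzero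
scalars, at least `(1 - ε) q^9`). -/
theorem many_irreducible_cubics (ε : ℝ) (hε : 0 < ε) :
    ∃ q₀ : ℕ, ∀ (q : ℕ), q₀ ≤ q → ∀ (F : Type) [Field F] [Fintype F],
      Fintype.card F = q →
        (1 - ε) * ((q : ℝ) - 1) * (q : ℝ) ^ 9 ≤
          ({p : MvPolynomial (Fin 3) F | p.IsHomogeneous 3 ∧ Irreducible p}.ncard : ℝ) := by
  refine ⟨0, fun q _ F _ _ hq => ?_⟩
  have h : (q : ℝ) ^ 10 ≤
      ({p : MvPolynomial (Fin 3) F | p.IsHomogeneous 3 ∧ Irreducible p}.ncard : ℝ) + q ^ 9 := by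
    rw [← hq]
    exact_mod_cast card_pow_ten_le_ncard_irreducible_cubics F
  have hq1 : (1 : ℝ) ≤ q := by
    rw [← hq]
    exact_mod_cast Fintype.card_pos (α := F)
  have hpos : 0 ≤ ε * (((q : ℝ) - 1) * q ^ 9) :=
    mul_nonneg hε.le (mul_nonneg (by linarith) (by positivity))
  linarith
end

section
/- There exists a constant C > 0 such that for every prime power q, the number of homogeneous polynomials of degree 3 in F_q[X, Y, Z] that are nonzero and reducible (i.e., admit a factorization into two nonconstant polynomials) is at most C · q^8. -/
namespace MvPolynomial

/-- The component of a product in degree `m + n`, when the factors have total degree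
at most `m` and `n`. -/
theorem homogeneousComponent_mul_of_totalDegree_le {σ R : Type*} [CommSemiring R]
    {a b : MvPolynomial σ R} {m n : ℕ} (ha : a.totalDegree ≤ m) (hb : b.totalDegree ≤ n) :
    homogeneousComponent (m + n) (a * b) =
      homogeneousComponent m a * homogeneousComponent n b := by
  classical
  ext d
  by_cases hd : d.degree = m + n
  · rw [coeff_homogeneousComponent, if_pos hd, coeff_mul, coeff_mul]
    refine Finset.sum_congr rfl fun x hx => ?_
    have hsum : x.1.degree + x.2.degree = m + n := by
      rw [← map_add, Finset.HasAntidiagonal.mem_antidiagonal.mp hx, hd]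
    simp only [coeff_homogeneousComponent]
    rcases lt_trichotomy x.1.degree m with h | h | h
    · have h2 : coeff x.2 b = 0 := coeff_eq_zero_of_totalDegree_lt (by
        change b.totalDegree < x.2.degree
        omega)
      simp [h2]
    · rw [if_pos h, if_pos (by omega)]
    · have h1 : coeff x.1 a = 0 := coeff_eq_zero_of_totalDegree_lt (by
        change a.totalDegree < x.1.degree
        omega)
      simp [h1]
  · rw [coeff_homogeneousComponent, if_neg hd]
    exact (((homogeneousComponent_isHomogeneous m a).mul
      (homogeneousComponent_isHomogeneous n b)).coeff_eq_zero hd).symm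

theorem IsHomogeneous.eq_sum_monomial {σ R : Type*} [Fintype σ] [DecidableEq σ] [CommSemiring R]
    {p : MvPolynomial σ R} {n : ℕ} (hp : p.IsHomogeneous n) :
    p = ∑ d : (Finset.univ : Finset σ).finsuppAntidiag n, monomial d.1 (coeff d.1 p) := by
  rw [Finset.sum_coe_sort _ fun d => monomial d (coeff d p)]
  conv_lhs => rw [p.as_sum]
  refine Finset.sum_subset (fun d hd => ?_) fun d _ hd => ?_
  · have h : d.degree = n := by
      by_contra h
      exact mem_support_iff.mp hd (hp.coeff_eq_zero h)
    rw [Finset.mem_finsuppAntidiag]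
    exact ⟨by rw [← h, Finsupp.degree_eq_sum], Finset.subset_univ _⟩
  · rw [notMem_support_iff.mp hd, monomial_zero]

theorem IsHomogeneous.eq_sum_C_mul_X {σ R : Type*} [Fintype σ] [CommSemiring R]
    {p : MvPolynomial σ R} (hp : p.IsHomogeneous 1) :
    p = ∑ i, C (coeff (Finsupp.single i 1) p) * X i := by
  classical
  have h : p ∈ homogeneousSubmodule σ R 1 := hp
  rw [homogeneousSubmodule_one_eq_span_X, Submodule.mem_span_range_iff_exists_fun] at h
  obtain ⟨c, rfl⟩ := h
  refine Finset.sum_congr rfl fun i _ => ?_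
  simp [coeff_sum, coeff_X, Finsupp.single_left_inj, smul_eq_C_mul]

/-- The product of the linear form with `i`-th coefficient `1` and remaining coefficients `c`,
and the quadratic form with coefficients `e`. -/
noncomputable def normalizedLinearMulQuadratic {F : Type*} [Field F]
    (x : Fin 3 × (Fin 2 → F) × ((Finset.univ : Finset (Fin 3)).finsuppAntidiag 2 → F)) :
    MvPolynomial (Fin 3) F :=
  (X x.1 + ∑ j, C (x.2.1 j) * X (x.1.succAbove j)) * ∑ d, monomial d.1 (x.2.2 d)

theorem linear_mul_quadratic_mem_range {F : Type*} [Field F] {l r : MvPolynomial (Fin 3) F}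
    (hl : l.IsHomogeneous 1) (hl0 : l ≠ 0) (hr : r.IsHomogeneous 2) :
    l * r ∈ Set.range (normalizedLinearMulQuadratic (F := F)) := by
  obtain ⟨i, hi⟩ : ∃ i, coeff (Finsupp.single i 1) l ≠ 0 := by
    by_contra! h
    apply hl0
    rw [hl.eq_sum_C_mul_X]
    simp [h]
  set u := coeff (Finsupp.single i 1) l
  refine ⟨(i, fun j => u⁻¹ * coeff (Finsupp.single (i.succAbove j) 1) l,
    fun d => coeff d.1 (C u * r)), ?_⟩
  have hlin : C u * (X i + ∑ j, C (u⁻¹ * coeff (Finsupp.single (i.succAbove j) 1) l) *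
      X (i.succAbove j)) = l := by
    conv_rhs => rw [hl.eq_sum_C_mul_X, Fin.sum_univ_succAbove _ i]
    rw [mul_add, Finset.mul_sum]
    congr 1
    refine Finset.sum_congr rfl fun j _ => ?_
    rw [← mul_assoc, ← C_mul, mul_inv_cancel_left₀ hi]
  simp only [normalizedLinearMulQuadratic]
  rw [← (hr.C_mul u).eq_sum_monomial]
  conv_rhs => rw [← hlin]
  ring

theorem mul_mem_range_of_totalDegree {F : Type*} [Field F] {a b : MvPolynomial (Fin 3) F}
    (hab : (a * b).IsHomogeneous 3) (h0 : a * b ≠ 0)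
    (ha : a.totalDegree = 1) (hb : b.totalDegree = 2) :
    a * b ∈ Set.range (normalizedLinearMulQuadratic (F := F)) := by
  have h : a * b = homogeneousComponent 1 a * homogeneousComponent 2 b := by
    rw [← homogeneousComponent_mul_of_totalDegree_le ha.le hb.le]
    exact (homogeneousComponent_eq_self hab).symm
  rw [h] at h0 ⊢
  exact linear_mul_quadratic_mem_range (homogeneousComponent_isHomogeneous 1 a)
    (left_ne_zero_of_mul h0) (homogeneousComponent_isHomogeneous 2 b)

theorem reducible_cubic_mem_range {F : Type*} [Field F] {a b : MvPolynomial (Fin 3) F}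
    (hab : (a * b).IsHomogeneous 3) (h0 : a * b ≠ 0)
    (ha : 0 < a.totalDegree) (hb : 0 < b.totalDegree) :
    a * b ∈ Set.range (normalizedLinearMulQuadratic (F := F)) := by
  have hdeg : a.totalDegree + b.totalDegree = 3 := by
    rw [← totalDegree_mul_of_isDomain (left_ne_zero_of_mul h0) (right_ne_zero_of_mul h0),
      hab.totalDegree h0]
  obtain h | h : a.totalDegree = 1 ∨ b.totalDegree = 1 := by omega
  · exact mul_mem_range_of_totalDegree hab h0 h (by omega)
  · rw [mul_comm] at hab h0 ⊢
    exact mul_mem_range_of_totalDegree hab h0 h (by omega)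

end MvPolynomial


/-- There is a constant `C > 0` such that for every finite field `F_q`, the number of
nonzero reducible homogeneous cubic polynomials in `F_q[X, Y, Z]` (products of two
nonconstant polynomials) is at most `C q^8`. -/
theorem few_reducible_cubics :
    ∃ C : ℝ, 0 < C ∧ ∀ (q : ℕ) (F : Type) [Field F] [Fintype F],
      Fintype.card F = q →
        ({p : MvPolynomial (Fin 3) F | p ≠ 0 ∧ p.IsHomogeneous 3 ∧
            ∃ a b : MvPolynomial (Fin 3) F,
              p = a * b ∧ 0 < a.totalDegree ∧ 0 < b.totalDegree}.ncard : ℝ) ≤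
          C * (q : ℝ) ^ 8 := by
  refine ⟨3, by norm_num, fun q F _ _ hq => ?_⟩
  have hcard : (Set.range (MvPolynomial.normalizedLinearMulQuadratic (F := F))).ncard ≤
      3 * q ^ 8 := by
    refine (Finite.card_range_le _).trans_eq ?_
    rw [Nat.card_eq_fintype_card]
    simp only [Fintype.card_prod, Fintype.card_fun, Fintype.card_fin, Fintype.card_coe,
      Finset.card_finsuppAntidiag_nat_eq_choose, Finset.card_univ, hq]
    rw [show Nat.choose (3 + 2 - 1) 2 = 6 from rfl, ← pow_add]
  refine le_trans (Nat.cast_le.mpr ((Set.ncard_le_ncard ?_ (Set.finite_range _)).trans hcard)) ?_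
  · rintro p ⟨h0, hp3, a, b, rfl, ha, hb⟩
    exact MvPolynomial.reducible_cubic_mem_range hp3 h0 ha hb
  · push_cast
    exact le_rfl
end
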